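/- arXiv:1504.07796 — 2 statements merged into one kernel-verified Lean document; each statement's English description precedes it below -/
import Mathlib

section
/- Let G be a 3-graph on 8 vertices that contains no copy of K₄⁻ and no copy of F₆, and suppose G contains an edge {a,b,c} such that G restricted to the remaining 5 vertices contains a copy of F₅ = {123,124,345}. Then G has at most 17 edges. -/
def K4mFree {V : Type*} [DecidableEq V] (E : Finset (Finset V)) : Prop :=
  ¬ ∃ a b c d : V, a ≠ b ∧ a ≠ c ∧ a ≠ d ∧ b ≠ c ∧ b ≠ d ∧ c ≠ d ∧
    ({a, b, c} : Finset V) ∈ E ∧ ({a, b, d} : Finset V) ∈ E ∧ ({a, c, d} : Finset V) ∈ E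

def F6Free {V : Type*} [DecidableEq V] (E : Finset (Finset V)) : Prop :=
  ¬ ∃ v₁ v₂ v₃ v₄ v₅ v₆ : V, ([v₁, v₂, v₃, v₄, v₅, v₆] : List V).Nodup ∧
    ({v₁, v₂, v₃} : Finset V) ∈ E ∧ ({v₁, v₂, v₄} : Finset V) ∈ E ∧
    ({v₃, v₄, v₅} : Finset V) ∈ E ∧ ({v₁, v₅, v₆} : Finset V) ∈ E

def vset (n : ℕ) : Finset (Fin 8) := Finset.univ.filter (fun i => n.testBit i.val = true)

def qq {V : Type*} [DecidableEq V] (φ : Fin 8 → V) (E : Finset (Finset V)) (n : ℕ) : Bool :=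
  decide ((vset n).image φ ∈ E)

def masks : List ℕ := [7, 11, 19, 35, 67, 131, 13, 21, 37, 69, 133, 25, 41, 73, 137, 49, 81, 145, 97, 161, 193, 14, 22, 38, 70, 134, 26, 42, 74, 138, 50, 82, 146, 98, 162, 194, 28, 44, 76, 140, 52, 84, 148, 100, 164, 196, 56, 88, 152, 104, 168, 200, 112, 176, 208, 224]

set_option maxRecDepth 100000 in
theorem masks_mem : ∀ i j k : Fin 8, i ≠ j → i ≠ k → j ≠ k →
    2 ^ i.val + 2 ^ j.val + 2 ^ k.val ∈ masks := by decide

set_option maxRecDepth 100000 in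
theorem vset_eq : ∀ i j k : Fin 8, i ≠ j → i ≠ k → j ≠ k →
    vset (2 ^ i.val + 2 ^ j.val + 2 ^ k.val) = {i, j, k} := by decide

theorem qq_iff {V : Type*} [DecidableEq V] (φ : Fin 8 → V) (E : Finset (Finset V))
    (i j k : Fin 8) (h : i ≠ j ∧ i ≠ k ∧ j ≠ k) :
    qq φ E (2 ^ i.val + 2 ^ j.val + 2 ^ k.val) = true ↔ ({φ i, φ j, φ k} : Finset V) ∈ E := by
  unfold qq
  rw [vset_eq i j k h.1 h.2.1 h.2.2]
  simp [Finset.image_insert]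

theorem card_le {V : Type*} [DecidableEq V] (φ : Fin 8 → V) (hφ : Function.Surjective φ)
    (E : Finset (Finset V)) (h3 : ∀ e ∈ E, e.card = 3) : E.card ≤ masks.countP (qq φ E) := by
  have hsub : E ⊆ ((masks.filter (qq φ E)).map (fun n => (vset n).image φ)).toFinset := by
    intro e he
    obtain ⟨x, y, z, hxy, hxz, hyz, rfl⟩ := Finset.card_eq_three.1 (h3 e he)
    obtain ⟨i, rfl⟩ := hφ x
    obtain ⟨j, rfl⟩ := hφ y
    obtain ⟨k, rfl⟩ := hφ z
    have hij : i ≠ j := fun h => hxy (by rw [h])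
    have hik : i ≠ k := fun h => hxz (by rw [h])
    have hjk : j ≠ k := fun h => hyz (by rw [h])
    rw [List.mem_toFinset, List.mem_map]
    refine ⟨2 ^ i.val + 2 ^ j.val + 2 ^ k.val, ?_, ?_⟩
    · rw [List.mem_filter]
      exact ⟨masks_mem i j k hij hik hjk, (qq_iff φ E i j k ⟨hij, hik, hjk⟩).2 he⟩
    · simp only [vset_eq i j k hij hik hjk, Finset.image_insert, Finset.image_singleton]
  calc E.card ≤ _ := Finset.card_le_card hsub
    _ ≤ _ := List.toFinset_card_le _
    _ = _ := by rw [List.length_map, List.countP_eq_length_filter]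

set_option synthInstance.maxSize 100000 in
set_option synthInstance.maxHeartbeats 1000000 in
set_option maxSynthPendingDepth 100 in
set_option maxRecDepth 100000 in
theorem g5_bool : ∀ b0 b1 b2 b3 b4 b5 b6 : Bool,
    (b1) = false →
    (b4) = false →
    (b0 && b5) = false →
    (b0 && b6) = false →
    (b2 && b3) = false →
    (b5 && b6) = false →
    (if b0 = true then 1 else 0) + (if b1 = true then 1 else 0) + (if b2 = true then 1 else 0) + (if b3 = true then 1 else 0) + (if b4 = true then 1 else 0) + (if b5 = true then 1 else 0) + (if b6 = true then 1 else 0) ≤ 2 := by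
  decide

set_option synthInstance.maxSize 100000 in
set_option synthInstance.maxHeartbeats 1000000 in
set_option maxSynthPendingDepth 100 in
set_option maxRecDepth 100000 in
theorem link_bool : ∀ b0 b1 b2 b3 b4 b5 b6 b7 b8 b9 : Bool,
    (b0 && b1) = false →
    (b0 && b2) = false →
    (b0 && b4) = false →
    (b0 && b5) = false →
    (b1 && b4) = false →
    (b7 && b8) = false →
    (b2 && b5) = false →
    (b7 && b9) = false →
    (b8 && b9) = false →
    (b1 && b2 && b7) = false →
    (b4 && b5 && b7) = false →
    (b3) = false →
    (b6) = false →
    (b1 && b5) = false →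
    (b4 && b2) = false →
    (b2 && b8) = false →
    (b5 && b8) = false →
    (b1 && b9) = false →
    (b4 && b9) = false →
    (if b0 = true then 1 else 0) + (if b1 = true then 1 else 0) + (if b2 = true then 1 else 0) + (if b3 = true then 1 else 0) + (if b4 = true then 1 else 0) + (if b5 = true then 1 else 0) + (if b6 = true then 1 else 0) + (if b7 = true then 1 else 0) + (if b8 = true then 1 else 0) + (if b9 = true then 1 else 0) ≤ 2 := by
  decide

theorem pair_bool : ∀ b0 b1 b2 : Bool,
    (b0 && b1) = false → (b0 && b2) = false → (b1 && b2) = false →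
    (if b0 = true then 1 else 0) + (if b1 = true then 1 else 0) + (if b2 = true then 1 else 0) ≤ 1 := by
  decide

theorem no1 (a : Bool) (h : a = true → False) : a = false := by
  cases a <;> simp_all

theorem no2 (a b : Bool) (h : a = true → b = true → False) : (a && b) = false := by
  cases a <;> cases b <;> simp_all

theorem no3 (a b c : Bool) (h : a = true → b = true → c = true → False) :
    (a && b && c) = false := by
  cases a <;> cases b <;> cases c <;> simp_all

/-- An `{K₄⁻, F₆}`-free 3-graph on 8 vertices having an edge `{a,b,c}` such that
the remaining 5 vertices contain a copy of `F₅` has at most 17 edges. -/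
theorem eight_vertex_bound {V : Type*} [DecidableEq V] [Fintype V]
    (hV : Fintype.card V = 8) (E : Finset (Finset V)) (h3 : ∀ e ∈ E, e.card = 3)
    (hK : K4mFree E) (hF : F6Free E)
    (a b c : V) (habc : ({a, b, c} : Finset V) ∈ E)
    (s t u v w : V) (hdist : ([s, t, u, v, w] : List V).Nodup)
    (hs : s ∉ ({a, b, c} : Finset V)) (ht : t ∉ ({a, b, c} : Finset V))
    (hu : u ∉ ({a, b, c} : Finset V)) (hv : v ∉ ({a, b, c} : Finset V))
    (hw : w ∉ ({a, b, c} : Finset V))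
    (h1 : ({s, t, u} : Finset V) ∈ E) (h2 : ({s, t, v} : Finset V) ∈ E)
    (h3' : ({u, v, w} : Finset V) ∈ E) :
    E.card ≤ 17 := by
  obtain ⟨φ, hφ⟩ : ∃ φ : Fin 8 → V, φ = ![s, t, u, v, w, a, b, c] := ⟨_, rfl⟩
  have hc : ([a, b, c] : List V).Nodup := by
    have h := h3 _ habc
    by_contra hn
    have h4 : ([a, b, c] : List V).toFinset.card = 3 := by simpa using h
    exact hn ((Multiset.toFinset_card_eq_card_iff_nodup (m := (([a, b, c] : List V) : Multiset V))).1 h4)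
  have hinj : Function.Injective φ := by
    have hl : ([s, t, u, v, w, a, b, c] : List V).Nodup := by
      simp only [List.nodup_cons, List.mem_cons, List.not_mem_nil, Finset.mem_insert,
        Finset.mem_singleton, not_or, or_false] at *
      tauto
    have h := List.nodup_iff_injective_get.1 hl
    intro i j hij
    apply h
    subst hφ
    fin_cases i <;> fin_cases j <;> first | exact hij | rfl
  have hsurj : Function.Surjective φ :=
    ((Fintype.bijective_iff_injective_and_card φ).2 ⟨hinj, by simp [hV]⟩).2
  have hK : ∀ i j k l : Fin 8, (i ≠ j ∧ i ≠ k ∧ i ≠ l ∧ j ≠ k ∧ j ≠ l ∧ k ≠ l) →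
      qq φ E (2 ^ i.val + 2 ^ j.val + 2 ^ k.val) = true →
      qq φ E (2 ^ i.val + 2 ^ j.val + 2 ^ l.val) = true →
      qq φ E (2 ^ i.val + 2 ^ k.val + 2 ^ l.val) = true → False := by
    rintro i j k l ⟨n1, n2, n3, n4, n5, n6⟩ q1 q2 q3
    rw [qq_iff φ E _ _ _ (by tauto)] at q1 q2 q3
    exact hK ⟨φ i, φ j, φ k, φ l, hinj.ne n1, hinj.ne n2, hinj.ne n3, hinj.ne n4, hinj.ne n5,
      hinj.ne n6, q1, q2, q3⟩
  have hF : ∀ i j k l m n : Fin 8, ([i, j, k, l, m, n] : List (Fin 8)).Nodup →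
      qq φ E (2 ^ i.val + 2 ^ j.val + 2 ^ k.val) = true →
      qq φ E (2 ^ i.val + 2 ^ j.val + 2 ^ l.val) = true →
      qq φ E (2 ^ k.val + 2 ^ l.val + 2 ^ m.val) = true →
      qq φ E (2 ^ i.val + 2 ^ m.val + 2 ^ n.val) = true → False := by
    intro i j k l m n hn q1 q2 q3 q4
    have hn' := hn.map hinj
    simp only [List.nodup_cons, List.mem_cons, List.not_mem_nil, not_or, or_false] at hn
    rw [qq_iff φ E _ _ _ (by tauto)] at q1 q2 q3 q4
    exact hF ⟨φ i, φ j, φ k, φ l, φ m, φ n, hn', q1, q2, q3, q4⟩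
  have P7 : qq φ E 7 = true := (qq_iff φ E 0 1 2 (by decide)).2 (by rw [hφ]; exact h1)
  have P11 : qq φ E 11 = true := (qq_iff φ E 0 1 3 (by decide)).2 (by rw [hφ]; exact h2)
  have P28 : qq φ E 28 = true := (qq_iff φ E 2 3 4 (by decide)).2 (by rw [hφ]; exact h3')
  have P224 : qq φ E 224 = true := (qq_iff φ E 5 6 7 (by decide)).2 (by rw [hφ]; exact habc)
  have g5 := g5_bool (qq φ E 19) (qq φ E 13) (qq φ E 21) (qq φ E 25) (qq φ E 14) (qq φ E 22) (qq φ E 26)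
    (no1 _ fun h13 => hK 0 1 2 3 (by decide) P7 P11 h13)
    (no1 _ fun h14 => hK 1 0 2 3 (by decide) P7 P11 h14)
    (no2 _ _ fun h19 h22 => hK 1 0 2 4 (by decide) P7 h19 h22)
    (no2 _ _ fun h19 h26 => hK 1 0 3 4 (by decide) P11 h19 h26)
    (no2 _ _ fun h21 h25 => hK 4 0 2 3 (by decide) h21 h25 P28)
    (no2 _ _ fun h22 h26 => hK 4 1 2 3 (by decide) h22 h26 P28)
  have l5 := link_bool (qq φ E 35) (qq φ E 37) (qq φ E 41) (qq φ E 49) (qq φ E 38) (qq φ E 42) (qq φ E 50) (qq φ E 44) (qq φ E 52) (qq φ E 56)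
    (no2 _ _ fun h35 h37 => hK 0 1 2 5 (by decide) P7 h35 h37)
    (no2 _ _ fun h35 h41 => hK 0 1 3 5 (by decide) P11 h35 h41)
    (no2 _ _ fun h35 h38 => hK 1 0 2 5 (by decide) P7 h35 h38)
    (no2 _ _ fun h35 h42 => hK 1 0 3 5 (by decide) P11 h35 h42)
    (no2 _ _ fun h37 h38 => hK 2 0 1 5 (by decide) P7 h37 h38)
    (no2 _ _ fun h44 h52 => hK 2 3 4 5 (by decide) P28 h44 h52)
    (no2 _ _ fun h41 h42 => hK 3 0 1 5 (by decide) P11 h41 h42)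
    (no2 _ _ fun h44 h56 => hK 3 2 4 5 (by decide) P28 h44 h56)
    (no2 _ _ fun h52 h56 => hK 4 2 3 5 (by decide) P28 h52 h56)
    (no3 _ _ _ fun h37 h41 h44 => hK 5 0 2 3 (by decide) h37 h41 h44)
    (no3 _ _ _ fun h38 h42 h44 => hK 5 1 2 3 (by decide) h38 h42 h44)
    (no1 _ fun h49 => hF 0 1 2 3 4 5 (by decide) P7 P11 P28 h49)
    (no1 _ fun h50 => hF 1 0 2 3 4 5 (by decide) P7 P11 P28 h50)
    (no2 _ _ fun h37 h42 => hF 2 0 1 5 3 4 (by decide) P7 h37 h42 P28)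
    (no2 _ _ fun h38 h41 => hF 2 1 0 5 3 4 (by decide) P7 h38 h41 P28)
    (no2 _ _ fun h41 h52 => hF 2 4 3 5 0 1 (by decide) P28 h52 h41 P7)
    (no2 _ _ fun h42 h52 => hF 2 4 3 5 1 0 (by decide) P28 h52 h42 P7)
    (no2 _ _ fun h37 h56 => hF 3 4 2 5 0 1 (by decide) P28 h56 h37 P11)
    (no2 _ _ fun h38 h56 => hF 3 4 2 5 1 0 (by decide) P28 h56 h38 P11)
  have l6 := link_bool (qq φ E 67) (qq φ E 69) (qq φ E 73) (qq φ E 81) (qq φ E 70) (qq φ E 74) (qq φ E 82) (qq φ E 76) (qq φ E 84) (qq φ E 88)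
    (no2 _ _ fun h67 h69 => hK 0 1 2 6 (by decide) P7 h67 h69)
    (no2 _ _ fun h67 h73 => hK 0 1 3 6 (by decide) P11 h67 h73)
    (no2 _ _ fun h67 h70 => hK 1 0 2 6 (by decide) P7 h67 h70)
    (no2 _ _ fun h67 h74 => hK 1 0 3 6 (by decide) P11 h67 h74)
    (no2 _ _ fun h69 h70 => hK 2 0 1 6 (by decide) P7 h69 h70)
    (no2 _ _ fun h76 h84 => hK 2 3 4 6 (by decide) P28 h76 h84)
    (no2 _ _ fun h73 h74 => hK 3 0 1 6 (by decide) P11 h73 h74)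
    (no2 _ _ fun h76 h88 => hK 3 2 4 6 (by decide) P28 h76 h88)
    (no2 _ _ fun h84 h88 => hK 4 2 3 6 (by decide) P28 h84 h88)
    (no3 _ _ _ fun h69 h73 h76 => hK 6 0 2 3 (by decide) h69 h73 h76)
    (no3 _ _ _ fun h70 h74 h76 => hK 6 1 2 3 (by decide) h70 h74 h76)
    (no1 _ fun h81 => hF 0 1 2 3 4 6 (by decide) P7 P11 P28 h81)
    (no1 _ fun h82 => hF 1 0 2 3 4 6 (by decide) P7 P11 P28 h82)
    (no2 _ _ fun h69 h74 => hF 2 0 1 6 3 4 (by decide) P7 h69 h74 P28)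
    (no2 _ _ fun h70 h73 => hF 2 1 0 6 3 4 (by decide) P7 h70 h73 P28)
    (no2 _ _ fun h73 h84 => hF 2 4 3 6 0 1 (by decide) P28 h84 h73 P7)
    (no2 _ _ fun h74 h84 => hF 2 4 3 6 1 0 (by decide) P28 h84 h74 P7)
    (no2 _ _ fun h69 h88 => hF 3 4 2 6 0 1 (by decide) P28 h88 h69 P11)
    (no2 _ _ fun h70 h88 => hF 3 4 2 6 1 0 (by decide) P28 h88 h70 P11)
  have l7 := link_bool (qq φ E 131) (qq φ E 133) (qq φ E 137) (qq φ E 145) (qq φ E 134) (qq φ E 138) (qq φ E 146) (qq φ E 140) (qq φ E 148) (qq φ E 152)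
    (no2 _ _ fun h131 h133 => hK 0 1 2 7 (by decide) P7 h131 h133)
    (no2 _ _ fun h131 h137 => hK 0 1 3 7 (by decide) P11 h131 h137)
    (no2 _ _ fun h131 h134 => hK 1 0 2 7 (by decide) P7 h131 h134)
    (no2 _ _ fun h131 h138 => hK 1 0 3 7 (by decide) P11 h131 h138)
    (no2 _ _ fun h133 h134 => hK 2 0 1 7 (by decide) P7 h133 h134)
    (no2 _ _ fun h140 h148 => hK 2 3 4 7 (by decide) P28 h140 h148)
    (no2 _ _ fun h137 h138 => hK 3 0 1 7 (by decide) P11 h137 h138)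
    (no2 _ _ fun h140 h152 => hK 3 2 4 7 (by decide) P28 h140 h152)
    (no2 _ _ fun h148 h152 => hK 4 2 3 7 (by decide) P28 h148 h152)
    (no3 _ _ _ fun h133 h137 h140 => hK 7 0 2 3 (by decide) h133 h137 h140)
    (no3 _ _ _ fun h134 h138 h140 => hK 7 1 2 3 (by decide) h134 h138 h140)
    (no1 _ fun h145 => hF 0 1 2 3 4 7 (by decide) P7 P11 P28 h145)
    (no1 _ fun h146 => hF 1 0 2 3 4 7 (by decide) P7 P11 P28 h146)
    (no2 _ _ fun h133 h138 => hF 2 0 1 7 3 4 (by decide) P7 h133 h138 P28)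
    (no2 _ _ fun h134 h137 => hF 2 1 0 7 3 4 (by decide) P7 h134 h137 P28)
    (no2 _ _ fun h137 h148 => hF 2 4 3 7 0 1 (by decide) P28 h148 h137 P7)
    (no2 _ _ fun h138 h148 => hF 2 4 3 7 1 0 (by decide) P28 h148 h138 P7)
    (no2 _ _ fun h133 h152 => hF 3 4 2 7 0 1 (by decide) P28 h152 h133 P11)
    (no2 _ _ fun h134 h152 => hF 3 4 2 7 1 0 (by decide) P28 h152 h134 P11)
  have p0 := pair_bool (qq φ E 97) (qq φ E 161) (qq φ E 193)
    (no2 _ _ fun h97 h161 => hK 5 6 7 0 (by decide) P224 h97 h161)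
    (no2 _ _ fun h97 h193 => hK 6 5 7 0 (by decide) P224 h97 h193)
    (no2 _ _ fun h161 h193 => hK 7 5 6 0 (by decide) P224 h161 h193)
  have p1 := pair_bool (qq φ E 98) (qq φ E 162) (qq φ E 194)
    (no2 _ _ fun h98 h162 => hK 5 6 7 1 (by decide) P224 h98 h162)
    (no2 _ _ fun h98 h194 => hK 6 5 7 1 (by decide) P224 h98 h194)
    (no2 _ _ fun h162 h194 => hK 7 5 6 1 (by decide) P224 h162 h194)
  have p2 := pair_bool (qq φ E 100) (qq φ E 164) (qq φ E 196)
    (no2 _ _ fun h100 h164 => hK 5 6 7 2 (by decide) P224 h100 h164)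
    (no2 _ _ fun h100 h196 => hK 6 5 7 2 (by decide) P224 h100 h196)
    (no2 _ _ fun h164 h196 => hK 7 5 6 2 (by decide) P224 h164 h196)
  have p3 := pair_bool (qq φ E 104) (qq φ E 168) (qq φ E 200)
    (no2 _ _ fun h104 h168 => hK 5 6 7 3 (by decide) P224 h104 h168)
    (no2 _ _ fun h104 h200 => hK 6 5 7 3 (by decide) P224 h104 h200)
    (no2 _ _ fun h168 h200 => hK 7 5 6 3 (by decide) P224 h168 h200)
  have p4 := pair_bool (qq φ E 112) (qq φ E 176) (qq φ E 208)
    (no2 _ _ fun h112 h176 => hK 5 6 7 4 (by decide) P224 h112 h176)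
    (no2 _ _ fun h112 h208 => hK 6 5 7 4 (by decide) P224 h112 h208)
    (no2 _ _ fun h176 h208 => hK 7 5 6 4 (by decide) P224 h176 h208)
  refine (card_le φ hsurj E h3).trans ?_
  simp only [masks, List.countP_cons, List.countP_nil, P7, P11, P28, P224, if_true]
  omega
end

section
/- For every n ≥ 3 with n ≠ 5, every 3-graph on n vertices containing no copy of K₄⁻ = {123,124,134} and no copy of F₆ = {123,124,345,156} has at most s₃(n) = ⌊n/3⌋·⌊(n+1)/3⌋·⌊(n+2)/3⌋ edges. -/
/-- Number of edges of the balanced complete tripartite 3-graph on `n` vertices. -/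
def s3 (n : ℕ) : ℕ := (n / 3) * ((n + 1) / 3) * ((n + 2) / 3)

open Classical in
/-- indicator -/
noncomputable def ii (p : Prop) : ℕ := if p then 1 else 0

lemma ii_le (p : Prop) : ii p ≤ 1 := by unfold ii; split_ifs <;> simp
lemma ii_t {p : Prop} (h : p) : ii p = 1 := by simp [ii, h]
lemma ii_f {p : Prop} (h : ¬ p) : ii p = 0 := by simp [ii, h]

set_option linter.unusedSectionVars false

section absw
variable {V : Type*} [DecidableEq V]

def DD (w : V → V → ℕ) (W : Finset V) : ℕ := ∑ x ∈ W, ∑ y ∈ W, w x y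

lemma DD_erase {w : V → V → ℕ} (ws : ∀ x y, w x y = w y x) (w0 : ∀ x, w x x = 0)
    {W : Finset V} {d : V} (hd : d ∈ W) :
    DD w W = DD w (W.erase d) + 2 * ∑ z ∈ W.erase d, w d z := by
  unfold DD
  rw [← Finset.add_sum_erase W _ hd, ← Finset.add_sum_erase W (fun y => w d y) hd, w0]
  have : ∀ x ∈ W.erase d, ∑ y ∈ W, w x y = w d x + ∑ y ∈ W.erase d, w x y := by
    intro x _
    rw [← Finset.add_sum_erase W _ hd, ws x d]
  rw [Finset.sum_congr rfl this, Finset.sum_add_distrib]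
  ring

lemma DD_pair {w : V → V → ℕ} (ws : ∀ x y, w x y = w y x) (w0 : ∀ x, w x x = 0)
    {W : Finset V} {d e : V} (hd : d ∈ W) (he : e ∈ W) (hde : d ≠ e) :
    DD w W = DD w ((W.erase d).erase e) + 2 * w d e +
      2 * ∑ z ∈ (W.erase d).erase e, (w d z + w e z) := by
  have he' : e ∈ W.erase d := by simp [he, hde.symm]
  rw [DD_erase ws w0 hd, DD_erase ws w0 he', ← Finset.add_sum_erase (W.erase d) (fun z => w d z) he',
    Finset.sum_add_distrib]
  ring

lemma DD_triple {w : V → V → ℕ} (ws : ∀ x y, w x y = w y x) (w0 : ∀ x, w x x = 0)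
    {W : Finset V} {d e f : V} (hd : d ∈ W) (he : e ∈ W) (hf : f ∈ W) (hde : d ≠ e) (hdf : d ≠ f)
    (hef : e ≠ f) :
    DD w W = DD w (((W.erase d).erase e).erase f) + 2 * (w d e + w d f + w e f) +
      2 * ∑ z ∈ ((W.erase d).erase e).erase f, (w d z + w e z + w f z) := by
  have hf' : f ∈ (W.erase d).erase e := by simp [hf, hdf.symm, hef.symm]
  rw [DD_pair ws w0 hd he hde, DD_erase ws w0 hf',
    ← Finset.add_sum_erase ((W.erase d).erase e) (fun z => w d z + w e z) hf',
    Finset.sum_add_distrib, Finset.sum_add_distrib, Finset.sum_add_distrib]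
  ring

lemma DD_quad {w : V → V → ℕ} (ws : ∀ x y, w x y = w y x) (w0 : ∀ x, w x x = 0)
    {W : Finset V} {d e f g : V} (hd : d ∈ W) (he : e ∈ W) (hf : f ∈ W) (hg : g ∈ W)
    (hde : d ≠ e) (hdf : d ≠ f) (hdg : d ≠ g)
    (hef : e ≠ f) (heg : e ≠ g) (hfg : f ≠ g) :
    DD w W = DD w ((((W.erase d).erase e).erase f).erase g) +
      2 * (w d e + w d f + w e f + w d g + w e g + w f g) +
      2 * ∑ z ∈ (((W.erase d).erase e).erase f).erase g, (w d z + w e z + w f z + w g z) := by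
  have hg' : g ∈ ((W.erase d).erase e).erase f := by simp [hg, hdg.symm, heg.symm, hfg.symm]
  rw [DD_triple ws w0 hd he hf hde hdf hef, DD_erase ws w0 hg',
    ← Finset.add_sum_erase (((W.erase d).erase e).erase f) (fun z => w d z + w e z + w f z) hg',
    Finset.sum_add_distrib (f := fun z => w d z + w e z + w f z)]
  ring

lemma t3_1 (N : ℕ) : (N + 3) * (N + 3) / 3 = N * N / 3 + 2 * N + 3 := by
  have : (N + 3) * (N + 3) = N * N + (2 * N + 3) * 3 := by ring
  rw [this, Nat.add_mul_div_right _ _ (by norm_num)]; ring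

lemma t3_2 (N : ℕ) : 3 * (N * N / 3) + 4 * N + 3 ≤ 3 * ((N + 2) * (N + 2) / 3) := by
  have : (N + 2) * (N + 2) = N * N + 4 * N + 4 := by ring
  rw [this]
  have h : N * N % 3 = 0 ∨ N * N % 3 = 1 ∧ N % 3 ≠ 0 := by
    have := Nat.mod_lt N (show 0 < 3 by norm_num)
    rw [Nat.mul_mod]
    interval_cases N % 3 <;> simp
  have h2 : N * N % 3 = 0 → N % 3 = 0 := by
    rw [Nat.mul_mod]
    have := Nat.mod_lt N (show 0 < 3 by norm_num)
    interval_cases N % 3 <;> simp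
  generalize N * N = M at *
  omega

lemma t3_4 (N : ℕ) : 3 * (N * N / 3) + 8 * N + 12 ≤ 3 * ((N + 4) * (N + 4) / 3) := by
  have h1 := t3_2 N
  have h2 := t3_2 (N + 2)
  have : N + 2 + 2 = N + 4 := rfl
  rw [this] at h2
  omega

/-- Turan for K4 -/
lemma lem4 {w : V → V → ℕ} (ws : ∀ x y, w x y = w y x) (w0 : ∀ x, w x x = 0) :
    ∀ (k : ℕ) (W : Finset V), W.card = k →
    (∀ x ∈ W, ∀ y ∈ W, w x y ≤ 1) →
    (∀ d ∈ W, ∀ e ∈ W, ∀ f ∈ W, ∀ g ∈ W, 1 ≤ w d e → 1 ≤ w d f → 1 ≤ w e f → 1 ≤ w d g →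
      1 ≤ w e g → 1 ≤ w f g → False) → DD w W ≤ 2 * (k * k / 3) := by
  intro k
  induction k using Nat.strong_induction_on with
  | _ k ih =>
  intro W hk h1 h4
  have nz : ∀ x y, 1 ≤ w x y → x ≠ y := by
    intro x y h e; subst e; rw [w0] at h; omega
  by_cases ht : ∃ d ∈ W, ∃ e ∈ W, ∃ f ∈ W, 1 ≤ w d e ∧ 1 ≤ w d f ∧ 1 ≤ w e f
  · obtain ⟨d, hd, e, he, f, hf, hde, hdf, hef⟩ := ht
    rw [DD_triple ws w0 hd he hf (nz _ _ hde) (nz _ _ hdf) (nz _ _ hef)]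
    have he' : e ∈ W.erase d := by simp [he, (nz _ _ hde).symm]
    have hf' : f ∈ (W.erase d).erase e := by simp [hf, (nz _ _ hdf).symm, (nz _ _ hef).symm]
    have a1 := Finset.card_erase_add_one hd
    have a2 := Finset.card_erase_add_one he'
    have a3 := Finset.card_erase_add_one hf'
    set R := ((W.erase d).erase e).erase f with hR
    have hc : R.card + 3 = k := by
      omega
    have hRW : R ⊆ W := by
      rw [hR]; exact (Finset.erase_subset _ _).trans ((Finset.erase_subset _ _).trans (Finset.erase_subset _ _))
    have i1 := ih R.card (by omega) R rfl (fun x hx y hy => h1 x (hRW hx) y (hRW hy))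
      (fun d hd e he f hf g hg => h4 d (hRW hd) e (hRW he) f (hRW hf) g (hRW hg))
    have i2 : ∑ z ∈ R, (w d z + w e z + w f z) ≤ ∑ z ∈ R, 2 := by
      apply Finset.sum_le_sum
      intro z hz
      have b1 := h1 d hd z (hRW hz)
      have b2 := h1 e he z (hRW hz)
      have b3 := h1 f hf z (hRW hz)
      by_contra hh
      exact h4 d hd e he f hf z (hRW hz) hde hdf hef (by omega) (by omega) (by omega)
    rw [Finset.sum_const, smul_eq_mul] at i2
    have b1 := h1 d hd e he
    have b2 := h1 d hd f hf
    have b3 := h1 e he f hf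
    have := t3_1 R.card
    rw [hc] at this
    omega
  · by_cases he : ∃ d ∈ W, ∃ e ∈ W, 1 ≤ w d e
    · obtain ⟨d, hd, e, he, hde⟩ := he
      rw [DD_pair ws w0 hd he (nz _ _ hde)]
      have he' : e ∈ W.erase d := by simp [he, (nz _ _ hde).symm]
      have a1 := Finset.card_erase_add_one hd
      have a2 := Finset.card_erase_add_one he'
      set R := ((W.erase d).erase e) with hR
      have hc : R.card + 2 = k := by
        omega
      have hRW : R ⊆ W := by
        rw [hR]; exact (Finset.erase_subset _ _).trans (Finset.erase_subset _ _)
      have i1 := ih R.card (by omega) R rfl (fun x hx y hy => h1 x (hRW hx) y (hRW hy))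
        (fun d hd e he f hf g hg => h4 d (hRW hd) e (hRW he) f (hRW hf) g (hRW hg))
      have i2 : ∑ z ∈ R, (w d z + w e z) ≤ ∑ z ∈ R, 1 := by
        apply Finset.sum_le_sum
        intro z hz
        have b1 := h1 d hd z (hRW hz)
        have b2 := h1 e he z (hRW hz)
        by_contra hh
        exact ht ⟨d, hd, e, he, z, hRW hz, hde, by omega, by omega⟩
      rw [Finset.sum_const, smul_eq_mul] at i2
      have b1 := h1 d hd e he
      have := t3_2 R.card
      rw [hc] at this
      omega
    · push Not at he
      have : DD w W = 0 := by
        unfold DD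
        apply Finset.sum_eq_zero
        intro x hx
        apply Finset.sum_eq_zero
        intro y hy
        have := he x hx y hy
        omega
      omega

noncomputable def uu (U : V → Prop) (W : Finset V) : ℕ := ∑ z ∈ W, ii (U z)

lemma uu_erase (U : V → Prop) {W : Finset V} {d : V} (hd : d ∈ W) :
    uu U W = uu U (W.erase d) + ii (U d) := by
  unfold uu
  rw [← Finset.add_sum_erase W _ hd]; ring

lemma uu_le (U : V → Prop) (W : Finset V) : uu U W ≤ W.card := by
  unfold uu
  calc _ ≤ ∑ z ∈ W, 1 := Finset.sum_le_sum (fun z _ => ii_le _)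
    _ = _ := by simp

def gg (N u : ℕ) : ℕ := if N = 2 ∧ u = 0 then 1 else 0

lemma ar3 {r k u D s p : ℕ} (hc : r + 2 = k) (t : 3 * (r * r / 3) + 4 * r + 3 ≤ 3 * (k * k / 3))
    (ul : u ≤ r) (i1 : D ≤ 2 * (r * r / 3 + u + gg r u)) (i2 : s ≤ u) (hw : p ≤ 2) :
    D + 2 * p + 2 * s ≤ 2 * (k * k / 3 + u + gg k u) := by
  by_cases hr : r ≤ 2
  · subst hc
    interval_cases r
    · interval_cases u
      simp [gg] at *; omega
    · interval_cases u <;> simp [gg] at * <;> omega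
    · interval_cases u <;> simp [gg] at * <;> omega
  · have : gg r u = 0 := by simp only [gg]; rw [if_neg]; omega
    omega

lemma ar2 {r k u q D s p : ℕ} (hc : r + 2 = k) (t : 3 * (r * r / 3) + 4 * r + 3 ≤ 3 * (k * k / 3))
    (i1 : D ≤ 2 * (r * r / 3 + u + gg r u)) (i2 : s ≤ r + u) (hw : p ≤ 1 + q) (hq : 1 ≤ q)
    (hu : 3 * (u + q) ≤ k + 3) :
    D + 2 * p + 2 * s ≤ 2 * (k * k / 3 + (u + q) + gg k (u + q)) := by
  by_cases hr : r = 2 ∧ u = 0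
  · obtain ⟨rfl, rfl⟩ := hr
    subst hc
    simp [gg] at *; omega
  · have : gg r u = 0 := by simp only [gg, if_neg hr]
    omega

structure AW (w : V → V → ℕ) (U : V → Prop) (W : Finset V) : Prop where
  ws : ∀ x y, w x y = w y x
  w0 : ∀ x, w x x = 0
  P1 : ∀ d ∈ W, ∀ e ∈ W, ∀ f ∈ W, 2 ≤ w d e → f ≠ d → f ≠ e → w d f + w e f ≤ 1 + ii (U f)
  P2 : ∀ d ∈ W, ∀ e ∈ W, 2 ≤ w d e → U d ∨ U e → w d e ≤ 1 + ii (U d) + ii (U e)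
  P3a : ∀ d ∈ W, ∀ e ∈ W, 2 ≤ w d e → ¬ U d → ¬ U e → w d e ≤ 2
  P3 : ∀ d ∈ W, ∀ e ∈ W, ∀ f ∈ W, 2 ≤ w d e → ¬ U d → ¬ U e → f ≠ d → f ≠ e →
    w d f + w e f ≤ ii (U f)
  P4 : ∀ d ∈ W, ∀ e ∈ W, ∀ f ∈ W, ∀ g ∈ W, 1 ≤ w d e → 1 ≤ w d f → 1 ≤ w e f → 1 ≤ w d g →
      1 ≤ w e g → 1 ≤ w f g → U d ∧ ∀ z ∈ W, ¬ U z → w d z = 0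

lemma AW.mono {w : V → V → ℕ} {U : V → Prop} {W R : Finset V} (h : AW w U W) (hs : R ⊆ W) :
    AW w U R where
  ws := h.ws
  w0 := h.w0
  P1 := fun d hd e he f hf => h.P1 d (hs hd) e (hs he) f (hs hf)
  P2 := fun d hd e he => h.P2 d (hs hd) e (hs he)
  P3a := fun d hd e he => h.P3a d (hs hd) e (hs he)
  P3 := fun d hd e he f hf => h.P3 d (hs hd) e (hs he) f (hs hf)
  P4 := fun d hd e he f hf g hg a b c i j k =>
    ⟨(h.P4 d (hs hd) e (hs he) f (hs hf) g (hs hg) a b c i j k).1,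
     fun z hz => (h.P4 d (hs hd) e (hs he) f (hs hf) g (hs hg) a b c i j k).2 z (hs hz)⟩

lemma lem3 {w : V → V → ℕ} {U : V → Prop} :
    ∀ (k : ℕ) (W : Finset V), W.card = k → AW w U W →
    (∀ d ∈ W, ∀ e ∈ W, 2 ≤ w d e → ¬ U d ∧ ¬ U e) →
    (∀ d ∈ W, ∀ e ∈ W, ∀ f ∈ W, ∀ g ∈ W, 1 ≤ w d e → 1 ≤ w d f → 1 ≤ w e f → 1 ≤ w d g →
      1 ≤ w e g → 1 ≤ w f g → False) →
    DD w W ≤ 2 * (k * k / 3 + uu U W + gg k (uu U W)) := by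
  intro k
  induction k using Nat.strong_induction_on with
  | _ k ih =>
  intro W hk h h2 h4
  have nz : ∀ x y, 1 ≤ w x y → x ≠ y := by
    intro x y hh e; subst e; rw [h.w0] at hh; omega
  by_cases hd : ∃ d ∈ W, ∃ e ∈ W, 2 ≤ w d e
  · obtain ⟨d, hd, e, he, hde⟩ := hd
    have hne := nz d e (by omega)
    obtain ⟨ud, ue⟩ := h2 d hd e he hde
    rw [DD_pair h.ws h.w0 hd he hne]
    have he' : e ∈ W.erase d := by simp [he, hne.symm]
    have u1 := uu_erase U hd
    have u2 := uu_erase U he'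
    rw [ii_f ud] at u1
    rw [ii_f ue] at u2
    have u3 := h.P3a d hd e he hde ud ue
    have a1 := Finset.card_erase_add_one hd
    have a2 := Finset.card_erase_add_one he'
    set R := ((W.erase d).erase e) with hR
    have hc : R.card + 2 = k := by
      omega
    have hRW : R ⊆ W := by
      rw [hR]; exact (Finset.erase_subset _ _).trans (Finset.erase_subset _ _)
    have i1 := ih R.card (by omega) R rfl (h.mono hRW) (fun x hx y hy => h2 x (hRW hx) y (hRW hy))
      (fun d hd e he f hf g hg => h4 d (hRW hd) e (hRW he) f (hRW hf) g (hRW hg))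
    have i2 : ∑ z ∈ R, (w d z + w e z) ≤ uu U R := by
      apply Finset.sum_le_sum
      intro z hz
      have hz' := hz
      rw [hR] at hz'
      simp only [Finset.mem_erase] at hz'
      exact h.P3 d hd e he z (hRW hz) hde ud ue hz'.2.1 hz'.1
    have := t3_2 R.card
    rw [hc] at this
    rw [show uu U W = uu U R by omega]
    exact ar3 hc this (uu_le U R) i1 i2 u3
  · push Not at hd
    have := lem4 h.ws h.w0 k W hk (fun x hx y hy => by have := hd x hx y hy; omega) h4
    omega

lemma lem2 {w : V → V → ℕ} {U : V → Prop} :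
    ∀ (k : ℕ) (W : Finset V), W.card = k → AW w U W → 3 * uu U W ≤ k + 3 → 
    DD w W ≤ 2 * (k * k / 3 + uu U W + gg k (uu U W)) := by
  intro k
  induction k using Nat.strong_induction_on with
  | _ k ih =>
  intro W hk h hu
  have nz : ∀ x y, 1 ≤ w x y → x ≠ y := by
    intro x y hh e; subst e; rw [h.w0] at hh; omega
  by_cases hd : ∃ d ∈ W, ∃ e ∈ W, 2 ≤ w d e ∧ (U d ∨ U e)
  · obtain ⟨d, hd, e, he, hde, hU⟩ := hd
    have hne := nz d e (by omega)
    rw [DD_pair h.ws h.w0 hd he hne]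
    have he' : e ∈ W.erase d := by simp [he, hne.symm]
    have u1 := uu_erase U hd
    have u2 := uu_erase U he'
    have u3 := h.P2 d hd e he hde hU
    have u4 : 1 ≤ ii (U d) + ii (U e) := by
      rcases hU with hU | hU <;> rw [ii_t hU] <;> omega
    have a1 := Finset.card_erase_add_one hd
    have a2 := Finset.card_erase_add_one he'
    set R := ((W.erase d).erase e) with hR
    have hc : R.card + 2 = k := by
      omega
    have hRW : R ⊆ W := by
      rw [hR]; exact (Finset.erase_subset _ _).trans (Finset.erase_subset _ _)
    have i1 := ih R.card (by omega) R rfl (h.mono hRW) (by omega)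
    have i2 : ∑ z ∈ R, (w d z + w e z) ≤ R.card + uu U R := by
      have : R.card + uu U R = ∑ z ∈ R, (1 + ii (U z)) := by
        rw [Finset.sum_add_distrib]; simp [uu]
      rw [this]
      apply Finset.sum_le_sum
      intro z hz
      have hz' := hz
      rw [hR] at hz'
      simp only [Finset.mem_erase] at hz'
      exact h.P1 d hd e he z (hRW hz) hde hz'.2.1 hz'.1
    have := t3_2 R.card
    rw [hc] at this
    rw [show uu U W = uu U R + (ii (U d) + ii (U e)) by omega]
    exact ar2 hc this i1 i2 (by omega) u4 (by omega)
  · by_cases hq : ∃ d ∈ W, ∃ e ∈ W, ∃ f ∈ W, ∃ g ∈ W, 1 ≤ w d e ∧ 1 ≤ w d f ∧ 1 ≤ w e f ∧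
      1 ≤ w d g ∧ 1 ≤ w e g ∧ 1 ≤ w f g
    · obtain ⟨d, hd', e, he, f, hf, g, hg, de, df, ef, dg, eg, fg⟩ := hq
      have s := h.ws
      have qd := h.P4 d hd' e he f hf g hg de df ef dg eg fg
      have qe := h.P4 e he d hd' f hf g hg (s d e ▸ de) ef df eg dg fg
      have qf := h.P4 f hf d hd' e he g hg (s d f ▸ df) (s e f ▸ ef) de fg dg eg
      have qg := h.P4 g hg d hd' e he f hf (s d g ▸ dg) (s e g ▸ eg) de (s f g ▸ fg) df ef
      rw [DD_quad h.ws h.w0 hd' he hf hg (nz _ _ de) (nz _ _ df) (nz _ _ dg) (nz _ _ ef)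
        (nz _ _ eg) (nz _ _ fg)]
      have he' : e ∈ W.erase d := by simp [he, (nz _ _ de).symm]
      have hf' : f ∈ (W.erase d).erase e := by simp [hf, (nz _ _ df).symm, (nz _ _ ef).symm]
      have hg' : g ∈ ((W.erase d).erase e).erase f := by
        simp [hg, (nz _ _ dg).symm, (nz _ _ eg).symm, (nz _ _ fg).symm]
      have u1 := uu_erase U hd'
      have u2 := uu_erase U he'
      have u3 := uu_erase U hf'
      have u4 := uu_erase U hg'
      rw [ii_t qd.1] at u1
      rw [ii_t qe.1] at u2
      rw [ii_t qf.1] at u3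
      rw [ii_t qg.1] at u4
      have a1 := Finset.card_erase_add_one hd'
      have a2 := Finset.card_erase_add_one he'
      have a3 := Finset.card_erase_add_one hf'
      have a4 := Finset.card_erase_add_one hg'
      set R := (((W.erase d).erase e).erase f).erase g with hR
      have hc : R.card + 4 = k := by
        omega
      have hRW : R ⊆ W := by
        rw [hR]
        exact (Finset.erase_subset _ _).trans ((Finset.erase_subset _ _).trans
          ((Finset.erase_subset _ _).trans (Finset.erase_subset _ _)))
      have i1 := ih R.card (by omega) R rfl (h.mono hRW) (by omega)
      push Not at hd
      have m1 : ∀ x ∈ W, U x → ∀ y ∈ W, w x y ≤ 1 := by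
        intro x hx ux y hy
        by_contra hh
        exact (hd x hx y hy (by omega)).1 ux
      have i2 : ∑ z ∈ R, (w d z + w e z + w f z + w g z) ≤ 4 * uu U R := by
        unfold uu
        rw [Finset.mul_sum]
        apply Finset.sum_le_sum
        intro z hz
        by_cases uz : U z
        · rw [ii_t uz]
          have := m1 d hd' qd.1 z (hRW hz)
          have := m1 e he qe.1 z (hRW hz)
          have := m1 f hf qf.1 z (hRW hz)
          have := m1 g hg qg.1 z (hRW hz)
          omega
        · have := qd.2 z (hRW hz) uz
          have := qe.2 z (hRW hz) uz
          have := qf.2 z (hRW hz) uz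
          have := qg.2 z (hRW hz) uz
          omega
      have := m1 d hd' qd.1 e he
      have := m1 d hd' qd.1 f hf
      have := m1 d hd' qd.1 g hg
      have := m1 e he qe.1 f hf
      have := m1 e he qe.1 g hg
      have := m1 f hf qf.1 g hg
      have t := t3_4 R.card
      rw [hc] at t
      have : gg R.card (uu U R) ≤ 1 := by unfold gg; split_ifs <;> omega
      omega
    · push Not at hd
      apply lem3 k W hk h
      · intro d hd1 e he1 hh
        have := hd d hd1 e he1 hh
        tauto
      · intro d hd e he f hf g hg a b c i j k
        exact hq ⟨d, hd, e, he, f, hf, g, hg, a, b, c, i, j, k⟩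
end absw

section loc
variable {V : Type*}

structure HT (T : V → V → V → Prop) : Prop where
  s1 : ∀ {x y z}, T x y z → T y x z
  s2 : ∀ {x y z}, T x y z → T x z y
  ne : ∀ {x y z}, T x y z → x ≠ y
  K : ∀ {x y z w}, T x y z → T x y w → T x z w → False
  F : ∀ {u v w x p y}, T u v w → T u v x → T w x p → T u p y → y = v ∨ y = w ∨ y = x

variable {T : V → V → V → Prop}

/-- y z x -/
lemma HT.r1 (h : HT T) {x y z : V} (t : T x y z) : T y z x := h.s2 (h.s1 t)
/-- z x y -/
lemma HT.r2 (h : HT T) {x y z : V} (t : T x y z) : T z x y := h.s1 (h.s2 t)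
/-- z y x -/
lemma HT.r3 (h : HT T) {x y z : V} (t : T x y z) : T z y x := h.s1 (h.r1 t)

def nU (T : V → V → V → Prop) (a b c f : V) : Prop := T b c f ∨ T a c f ∨ T a b f

noncomputable def wt (T : V → V → V → Prop) (a b c x y : V) : ℕ :=
  ii (T a x y) + ii (T b x y) + ii (T c x y)

/-- new vertex -/
def off (a b c x : V) : Prop := x ≠ a ∧ x ≠ b ∧ x ≠ c

variable {a b c d e f g z : V}

lemma dblc (h : HT T) (t : T a b c) (ta : T a d e) (tb : T b d e) (of : off a b c f)
    (hfe : f ≠ e) : ¬ T c d f := by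
  intro q
  rcases h.F (h.r1 ta) (h.r1 tb) t (h.s1 q) with r | r | r
  · exact hfe r
  · exact of.1 r
  · exact of.2.1 r

lemma dbl3 (h : HT T) (t : T a b c) (ta : T a d e) (p : T a d f) (q : T b e f)
    (od : off a b c d) (oe : off a b c e) (of : off a b c f) : False := by
  rcases h.F ta p (h.r1 q) t with r | r | r
  · exact od.2.2 r.symm
  · exact oe.2.2 r.symm
  · exact of.2.2 r.symm

lemma dbl4 (h : HT T) (t : T a b c) (ta : T a d e) (tb : T b d e) (p : T a d f) (q : T b d f)
    (oe : off a b c e) (hef : e ≠ f) : ¬ nU T a b c f := by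
  rintro (r | r | r)
  · rcases h.F (h.r1 t) r (h.s2 p) tb with s | s | s
    · exact oe.2.2 s
    · exact oe.1 s
    · exact hef s
  · rcases h.F (h.s2 t) r (h.s2 q) ta with s | s | s
    · exact oe.2.2 s
    · exact oe.2.1 s
    · exact hef s
  · exact h.K (h.r2 r) (h.r2 p) (h.r2 q)

lemma nU12 (h : HT T) : nU T a b c f → nU T b a c f := by
  rintro (r | r | r)
  · exact Or.inr (Or.inl r)
  · exact Or.inl r
  · exact Or.inr (Or.inr (h.s1 r))
lemma nU23 (h : HT T) : nU T a b c f → nU T a c b f := by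
  rintro (r | r | r)
  · exact Or.inl (h.s1 r)
  · exact Or.inr (Or.inr r)
  · exact Or.inr (Or.inl r)
lemma off12 : off a b c f → off b a c f := fun h => ⟨h.2.1, h.1, h.2.2⟩
lemma off23 : off a b c f → off a c b f := fun h => ⟨h.1, h.2.2, h.2.1⟩
lemma wt12 (x y : V) : wt T a b c x y = wt T b a c x y := by unfold wt; ring
lemma wt23 (x y : V) : wt T a b c x y = wt T a c b x y := by unfold wt; ring
lemma nU12' (h : HT T) (f : V) : nU T a b c f = nU T b a c f := propext ⟨nU12 h, nU12 h⟩
lemma nU23' (h : HT T) (f : V) : nU T a b c f = nU T a c b f := propext ⟨nU23 h, nU23 h⟩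
lemma wtsymm (h : HT T) (x y : V) : wt T a b c x y = wt T a b c y x := by
  have : ∀ p, T p x y = T p y x := fun p => propext ⟨h.s2, h.s2⟩
  simp only [wt, this]
lemma wt0 (h : HT T) (x : V) : wt T a b c x x = 0 := by
  have : ∀ p, ¬ T p x x := fun p q => h.ne (h.r1 q) rfl
  simp [wt, this, ii]

/-- reduce a double pair to colours a,b by symmetry -/
lemma dblwlog (h : HT T) (P : V → V → V → Prop) (p12 : ∀ a b c, P a b c → P b a c)
    (p23 : ∀ a b c, P a b c → P a c b) (h2 : 2 ≤ wt T a b c d e) (t : T a b c)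
    (H : ∀ a b c, T a b c → T a d e → T b d e → P a b c) : P a b c := by
  by_cases ha : T a d e
  · by_cases hb : T b d e
    · exact H a b c t ha hb
    · by_cases hc : T c d e
      · exact p23 _ _ _ (H a c b (h.s2 t) ha hc)
      · simp [wt, ii, ha, hb, hc] at h2
  · by_cases hb : T b d e
    · by_cases hc : T c d e
      · exact p12 _ _ _ (p23 _ _ _ (H b c a (h.r1 t) hb hc))
      · simp [wt, ii, ha, hb, hc] at h2
    · unfold wt at h2
      rw [ii_f ha, ii_f hb] at h2
      have := ii_le (T c d e)
      omega

/-- core form of P1 -/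
lemma P1core (h : HT T) (t : T a b c) (ta : T a d e) (tb : T b d e) (od : off a b c d)
    (oe : off a b c e) (of : off a b c f) (hfd : f ≠ d) (hfe : f ≠ e) :
    wt T a b c d f + wt T a b c e f ≤ 1 ∨
    (¬ nU T a b c f ∧ wt T a b c d f + wt T a b c e f = 2 ∧
      (2 ≤ wt T a b c d f ∨ 2 ≤ wt T a b c e f)) := by
  have c1 : ¬ T c d f := dblc h t ta tb of hfe
  have c2 : ¬ T c e f := dblc h t (h.s2 ta) (h.s2 tb) of hfd
  have k1 : T a d f → T a e f → False := fun p q => h.K ta p q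
  have k2 : T b d f → T b e f → False := fun p q => h.K tb p q
  have k3 : T a d f → T b e f → False := fun p q => dbl3 h t ta p q od oe of
  have k4 : T a e f → T b d f → False := fun p q => dbl3 h t (h.s2 ta) p q oe od of
  have k5 : T a d f → T b d f → ¬ nU T a b c f := fun p q => dbl4 h t ta tb p q oe hfe.symm
  have k6 : T a e f → T b e f → ¬ nU T a b c f :=
    fun p q => dbl4 h t (h.s2 ta) (h.s2 tb) p q od hfd.symm
  unfold wt
  by_cases x1 : T a d f <;> by_cases x2 : T b d f <;> by_cases x3 : T a e f <;>
    by_cases x4 : T b e f <;> simp [ii, c1, c2, x1, x2, x3, x4] <;> tauto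

lemma P1pre (h : HT T) (t : T a b c) (h2 : 2 ≤ wt T a b c d e) (od : off a b c d)
    (oe : off a b c e) (of : off a b c f) (hfd : f ≠ d) (hfe : f ≠ e) :
    wt T a b c d f + wt T a b c e f ≤ 1 ∨
    (¬ nU T a b c f ∧ wt T a b c d f + wt T a b c e f = 2 ∧
      (2 ≤ wt T a b c d f ∨ 2 ≤ wt T a b c e f)) := by
  refine dblwlog h (fun a b c => off a b c d → off a b c e → off a b c f →
    (wt T a b c d f + wt T a b c e f ≤ 1 ∨
    (¬ nU T a b c f ∧ wt T a b c d f + wt T a b c e f = 2 ∧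
      (2 ≤ wt T a b c d f ∨ 2 ≤ wt T a b c e f)))) ?_ ?_ h2 t ?_ od oe of
  · intro a b c hh x y z
    have := hh (off12 x) (off12 y) (off12 z)
    rwa [wt12 d f, wt12 e f, nU12' h] at this
  · intro a b c hh x y z
    have := hh (off23 x) (off23 y) (off23 z)
    rwa [wt23 d f, wt23 e f, nU23' h] at this
  · intro a b c t ta tb x y z
    exact P1core h t ta tb x y z hfd hfe

lemma P1 (h : HT T) (t : T a b c) (h2 : 2 ≤ wt T a b c d e) (od : off a b c d)
    (oe : off a b c e) (of : off a b c f) (hfd : f ≠ d) (hfe : f ≠ e) :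
    wt T a b c d f + wt T a b c e f ≤ 1 + ii (¬ nU T a b c f) := by
  rcases P1pre h t h2 od oe of hfd hfe with r | ⟨r, s, _⟩
  · omega
  · rw [ii_t r]; omega

lemma P23 (h : HT T) (hd : nU T a b c d) : wt T a b c d e ≤ 2 := by
  by_contra hh
  have : T a d e ∧ T b d e ∧ T c d e := by
    by_contra h3
    apply hh
    unfold wt
    have h1 := ii_le (T a d e)
    have h2 := ii_le (T b d e)
    have h4 := ii_le (T c d e)
    by_cases x : T a d e
    · by_cases y : T b d e
      · have : ¬ T c d e := fun z => h3 ⟨x, y, z⟩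
        rw [ii_f this]; omega
      · rw [ii_f y]; omega
    · rw [ii_f x]; omega
  obtain ⟨x, y, z⟩ := this
  rcases hd with q | q | q
  · exact h.K (h.r2 q) (h.s1 y) (h.s1 z)
  · exact h.K (h.r2 q) (h.s1 x) (h.s1 z)
  · exact h.K (h.r2 q) (h.s1 x) (h.s1 y)

/-- the AB double case, f not in U -/
lemma P3core' (h : HT T) (t : T a b c) (ta : T a d e) (tb : T b d e) (qd : T b c d) (qe : T a c e)
    (od : off a b c d) (oe : off a b c e) (of : off a b c f) (hfd : f ≠ d) (hfe : f ≠ e)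
    (nf : nU T a b c f) : wt T a b c d f = 0 := by
  have c1 : ¬ T c d f := dblc h t ta tb of hfe
  have x1 : ¬ T a d f := by
    intro p
    rcases h.F (h.s2 t) qe (h.s2 tb) p with r | r | r
    · exact of.2.2 r
    · exact of.2.1 r
    · exact hfe r
  have x2 : ¬ T b d f := by
    intro p
    rcases nf with q | q | q
    · exact h.K qd q p
    · -- f in B, T a c f, T b d f : F (a,c;b,f;d) : N(ad)
      rcases h.F (h.s2 t) q (h.s2 p) ta with r | r | r
      · exact oe.2.2 r
      · exact oe.2.1 r
      · exact hfe r.symm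
    · -- f in C
      rcases h.F (h.s2 qe) (h.s2 ta) (h.r1 qd) q with r | r | r
      · exact hfe r
      · exact of.2.2 r
      · exact hfd r
  simp [wt, ii, c1, x1, x2]

lemma P3core (h : HT T) (t : T a b c) (ta : T a d e) (tb : T b d e)
    (nd : nU T a b c d) (ne : nU T a b c e)
    (od : off a b c d) (oe : off a b c e) (of : off a b c f) (hfd : f ≠ d) (hfe : f ≠ e)
    (nf : nU T a b c f) : wt T a b c d f + wt T a b c e f = 0 := by
  rcases nd with qd | qd | qd
  · rcases ne with qe | qe | qe
    · exact (h.K qd qe tb).elim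
    · have e1 := P3core' h t ta tb qd qe od oe of hfd hfe nf
      have e2 := P3core' h (h.s1 t) (h.s2 tb) (h.s2 ta) qe qd (off12 oe) (off12 od) (off12 of)
        hfe hfd (nU12 h nf)
      rw [wt12] at e2
      omega
    · exact (h.K (h.r2 qe) (h.r2 ta) (h.r2 tb)).elim
  · rcases ne with qe | qe | qe
    · have e1 := P3core' h t (h.s2 ta) (h.s2 tb) qe qd oe od of hfe hfd nf
      have e2 := P3core' h (h.s1 t) tb ta qd qe (off12 od) (off12 oe) (off12 of)
        hfd hfe (nU12 h nf)
      rw [wt12] at e2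
      omega
    · exact (h.K qd qe ta).elim
    · exact (h.K (h.r2 qe) (h.r2 ta) (h.r2 tb)).elim
  · exact (h.K (h.r2 qd) (h.s1 ta) (h.s1 tb)).elim

lemma P3 (h : HT T) (t : T a b c) (h2 : 2 ≤ wt T a b c d e)
    (nd : nU T a b c d) (ne : nU T a b c e)
    (od : off a b c d) (oe : off a b c e) (of : off a b c f) (hfd : f ≠ d) (hfe : f ≠ e) :
    wt T a b c d f + wt T a b c e f ≤ ii (¬ nU T a b c f) := by
  by_cases nf : nU T a b c f
  · have : wt T a b c d f + wt T a b c e f = 0 := by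
      refine dblwlog h (fun a b c => off a b c d → off a b c e → off a b c f →
        nU T a b c d → nU T a b c e → nU T a b c f →
        wt T a b c d f + wt T a b c e f = 0) ?_ ?_ h2 t ?_ od oe of nd ne nf
      · intro a b c hh x y z u v w
        have := hh (off12 x) (off12 y) (off12 z) (nU12 h u) (nU12 h v) (nU12 h w)
        rwa [wt12 d f, wt12 e f] at this
      · intro a b c hh x y z u v w
        have := hh (off23 x) (off23 y) (off23 z) (nU23 h u) (nU23 h v) (nU23 h w)
        rwa [wt23 d f, wt23 e f] at this
      · intro a b c t ta tb x y z u v w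
        exact P3core h t ta tb u v x y z hfd hfe w
    omega
  · rw [ii_t nf]
    rcases P1pre h t h2 od oe of hfd hfe with r | ⟨r, s, q | q⟩
    · exact r
    · have hed : e ≠ d := by
        rintro rfl
        rw [wt0 h] at h2; omega
      have := P1 h t q od of oe hed hfe.symm
      rw [ii_f (not_not.mpr ne)] at this
      omega
    · have hed : d ≠ e := by
        rintro rfl
        rw [wt0 h] at h2; omega
      have := P1 h t q oe of od hed hfd.symm
      rw [ii_f (not_not.mpr nd), wtsymm h] at this
      omega

lemma fano1 (h : HT T) (l1 : T a d e) (l2 : T b d f) (l3 : T c d g)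
    (l4 : T c e f) (l5 : T b e g) (l6 : T a f g)
    (of : off a b c f) (og : off a b c g) : ¬ nU T a b c d := by
  have hdg : d ≠ g := h.ne (h.r1 l3)
  have hfg : f ≠ g := h.ne (h.r1 l6)
  have hdf : d ≠ f := h.ne (h.r1 l2)
  have heg : e ≠ g := h.ne (h.r1 l5)
  have hef : e ≠ f := h.ne (h.r1 l4)
  rintro (q | q | q)
  · rcases h.F (h.s2 q) l2 (h.s2 l4) l5 with r | r | r
    · exact hdg r.symm
    · exact og.2.2 r
    · exact hfg r.symm
  · rcases h.F (h.s2 q) l1 l4 l6 with r | r | r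
    · exact hdg r.symm
    · exact og.2.2 r
    · exact heg r.symm
  · rcases h.F (h.s2 q) l1 l5 (h.s2 l6) with r | r | r
    · exact hdf r.symm
    · exact of.2.1 r
    · exact hef r.symm

lemma fano2 (h : HT T) (t : T a b c) (l2 : T b d f) (l3 : T c d g) (l6 : T a f g)
    (of : off a b c f) (og : off a b c g) (nz : nU T a b c z)
    (zf : z ≠ f) (zg : z ≠ g) : ¬ T a d z := by
  intro p
  have hdg : d ≠ g := h.ne (h.r1 l3)
  have hdf : d ≠ f := h.ne (h.r1 l2)
  rcases nz with q | q | q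
  · rcases h.F (h.r1 t) q (h.s2 p) l2 with r | r | r
    · exact of.2.2 r
    · exact of.1 r
    · exact zf r.symm
  · rcases h.F (h.s2 q) (h.s2 p) l3 (h.s2 l6) with r | r | r
    · exact zf r.symm
    · exact of.2.2 r
    · exact hdf r.symm
  · rcases h.F (h.s2 q) (h.s2 p) l2 l6 with r | r | r
    · exact zg r.symm
    · exact og.2.1 r
    · exact hdg r.symm

lemma fano (h : HT T) (t : T a b c) (l1 : T a d e) (l2 : T b d f) (l3 : T c d g)
    (l4 : T c e f) (l5 : T b e g) (l6 : T a f g)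
    (od : off a b c d) (oe : off a b c e) (of : off a b c f) (og : off a b c g) :
    ¬ nU T a b c d ∧ ∀ z, nU T a b c z → wt T a b c d z = 0 := by
  have nd := fano1 h l1 l2 l3 l4 l5 l6 of og
  have ne := fano1 h (h.s2 l1) l5 l4 l3 l2 (h.s2 l6) og of
  have nf : ¬ nU T a b c f := fano1 h l6 (h.s2 l2) (h.s2 l4) (h.s2 l3) (h.s2 l5) l1 od oe
  have ng : ¬ nU T a b c g := fano1 h (h.s2 l6) (h.s2 l5) (h.s2 l3) (h.s2 l4) (h.s2 l2)
    (h.s2 l1) oe od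
  refine ⟨nd, fun z nz => ?_⟩
  have ze : z ≠ e := by rintro rfl; exact ne nz
  have zf : z ≠ f := by rintro rfl; exact nf nz
  have zg : z ≠ g := by rintro rfl; exact ng nz
  have x1 : ¬ T a d z := fano2 h t l2 l3 l6 of og nz zf zg
  have x2 : ¬ T b d z := fano2 h (h.s1 t) l1 l3 l5 (off12 oe) (off12 og) (nU12 h nz) ze zg
  have x3 : ¬ T c d z := fano2 h (h.r2 t) l1 l2 l4 (off12 (off23 oe)) (off12 (off23 of))
    (nU12 h (nU23 h nz)) ze zf
  simp [wt, ii, x1, x2, x3]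

lemma col_of (hw : 1 ≤ wt T a b c d e) : T a d e ∨ T b d e ∨ T c d e := by
  by_contra hh
  push Not at hh
  simp [wt, ii, hh] at hw

/-- a rainbow star forces the rest -/
lemma star1 (h : HT T) (t : T a b c) (l1 : T a d e) (l2 : T b d f) (hw : 1 ≤ wt T a b c e f)
    (od : off a b c d) (oe : off a b c e) (of : off a b c f) : T c e f := by
  rcases col_of hw with r | r | r
  · -- a d e, a e f, b d f  
    exact (dbl3 h t (h.s2 l1) r l2 oe od of).elim
  · exact (dbl3 h (h.s1 t) (h.s2 l2) (h.s2 r) l1 (off12 of) (off12 od) (off12 oe)).elim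
  · exact r

/-- two edges at d of a triangle have different colours -/
lemma star0 (h : HT T) (t : T a b c) (l1 : T a d e) (l2 : T a d f) (hw : 1 ≤ wt T a b c e f)
    (od : off a b c d) (oe : off a b c e) (of : off a b c f) : False := by
  rcases col_of hw with r | r | r
  · exact h.K l1 l2 r
  · exact dbl3 h t l1 l2 r od oe of
  · exact dbl3 h (h.s2 t) l1 l2 r (off23 od) (off23 oe) (off23 of)

lemma P4a (h : HT T) (t : T a b c) (l1 : T a d e) (l2 : T b d f) (l3 : T c d g)
    (ef : 1 ≤ wt T a b c e f) (eg : 1 ≤ wt T a b c e g) (fg : 1 ≤ wt T a b c f g)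
    (od : off a b c d) (oe : off a b c e) (of : off a b c f) (og : off a b c g) :
    ¬ nU T a b c d ∧ ∀ z, nU T a b c z → wt T a b c d z = 0 := by
  have l4 := star1 h t l1 l2 ef od oe of
  have l5 : T b e g := star1 h (h.s2 t) l1 l3 (by rwa [← wt23]) (off23 od) (off23 oe) (off23 og)
  have l6 : T a f g := star1 h (h.r1 t) l2 l3 (by rwa [← wt23, ← wt12])
    (off23 (off12 od)) (off23 (off12 of)) (off23 (off12 og))
  exact fano h t l1 l2 l3 l4 l5 l6 od oe of og

/-- first edge has colour a -/
lemma P4b (h : HT T) (t : T a b c) (l1 : T a d e) (df : 1 ≤ wt T a b c d f)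
    (dg : 1 ≤ wt T a b c d g)
    (ef : 1 ≤ wt T a b c e f) (eg : 1 ≤ wt T a b c e g) (fg : 1 ≤ wt T a b c f g)
    (od : off a b c d) (oe : off a b c e) (of : off a b c f) (og : off a b c g) :
    ¬ nU T a b c d ∧ ∀ z, nU T a b c z → wt T a b c d z = 0 := by
  rcases col_of df with r | r | r
  · exact (star0 h t l1 r ef od oe of).elim
  · rcases col_of dg with s | s | s
    · exact (star0 h t l1 s eg od oe og).elim
    · exact (star0 h (h.s1 t) r s (by rwa [← wt12]) (off12 od) (off12 of) (off12 og)).elim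
    · exact P4a h t l1 r s ef eg fg od oe of og
  · rcases col_of dg with s | s | s
    · exact (star0 h t l1 s eg od oe og).elim
    · exact P4a h t l1 s r eg ef (by rwa [wtsymm h]) od oe og of
    · exact (star0 h (h.r2 t) r s (by rwa [← wt12, ← wt23]) (off12 (off23 od))
        (off12 (off23 of)) (off12 (off23 og))).elim

lemma P4 (h : HT T) (t : T a b c) (de : 1 ≤ wt T a b c d e) (df : 1 ≤ wt T a b c d f)
    (dg : 1 ≤ wt T a b c d g)
    (ef : 1 ≤ wt T a b c e f) (eg : 1 ≤ wt T a b c e g) (fg : 1 ≤ wt T a b c f g)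
    (od : off a b c d) (oe : off a b c e) (of : off a b c f) (og : off a b c g) :
    ¬ nU T a b c d ∧ ∀ z, nU T a b c z → wt T a b c d z = 0 := by
  rcases col_of de with l | l | l
  · exact P4b h t l df dg ef eg fg od oe of og
  · have := P4b h (h.s1 t) l (by rwa [← wt12]) (by rwa [← wt12]) (by rwa [← wt12])
      (by rwa [← wt12]) (by rwa [← wt12]) (off12 od) (off12 oe) (off12 of) (off12 og)
    refine ⟨fun q => this.1 (nU12 h q), fun z hz => ?_⟩
    rw [wt12]; exact this.2 z (nU12 h hz)
  · have := P4b h (h.r2 t) l (by rwa [← wt12, ← wt23]) (by rwa [← wt12, ← wt23])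
      (by rwa [← wt12, ← wt23]) (by rwa [← wt12, ← wt23]) (by rwa [← wt12, ← wt23])
      (off12 (off23 od)) (off12 (off23 oe)) (off12 (off23 of)) (off12 (off23 og))
    refine ⟨fun q => this.1 (nU12 h (nU23 h q)), fun z hz => ?_⟩
    rw [wt23, wt12]; exact this.2 z (nU12 h (nU23 h hz))

lemma mkAW (h : HT T) (t : T a b c) (W : Finset V) (hW : ∀ x ∈ W, off a b c x) :
    AW (wt T a b c) (fun x => ¬ nU T a b c x) W where
  ws := wtsymm h
  w0 := wt0 h
  P1 := fun d hd e he f hf h2 => P1 h t h2 (hW d hd) (hW e he) (hW f hf)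
  P2 := by
    intro d hd e he h2 hu
    by_cases nd : nU T a b c d
    · have := P23 h nd (e := e)
      have hu' : ¬ nU T a b c e := by tauto
      rw [ii_t hu']; omega
    · by_cases ne : nU T a b c e
      · have := P23 h ne (e := d)
        rw [wtsymm h] at this
        rw [ii_t nd]; omega
      · rw [ii_t nd, ii_t ne]
        unfold wt
        have := ii_le (T a d e)
        have := ii_le (T b d e)
        have := ii_le (T c d e)
        omega
  P3a := fun d hd e he h2 ud ue => P23 h (not_not.mp ud)
  P3 := fun d hd e he f hf h2 ud ue => P3 h t h2 (not_not.mp ud) (not_not.mp ue)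
    (hW d hd) (hW e he) (hW f hf)
  P4 := by
    intro d hd e he f hf g hg de df ef dg eg fg
    have := P4 h t de df dg ef eg fg (hW d hd) (hW e he) (hW f hf) (hW g hg)
    exact ⟨this.1, fun z _ hz => this.2 z (not_not.mp hz)⟩
end loc

section cnt
variable {V : Type*} [DecidableEq V] {T : V → V → V → Prop} {a b c : V}

noncomputable def tt (T : V → V → V → Prop) (X : Finset V) : ℕ :=
  ∑ x ∈ X, ∑ y ∈ X, ∑ z ∈ X, ii (T x y z)

noncomputable def LL (T : V → V → V → Prop) (a : V) (X : Finset V) : ℕ :=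
  DD (fun y z => ii (T a y z)) X

lemma iis1 (h : HT T) (x y z : V) : ii (T x y z) = ii (T y x z) := by
  rw [show T x y z = T y x z from propext ⟨h.s1, h.s1⟩]
lemma iis2 (h : HT T) (x y z : V) : ii (T x y z) = ii (T x z y) := by
  rw [show T x y z = T x z y from propext ⟨h.s2, h.s2⟩]
lemma ii0 (h : HT T) (x y : V) : ii (T x y y) = 0 := ii_f (fun q => h.ne (h.r1 q) rfl)
lemma ii0' (h : HT T) (x y : V) : ii (T x x y) = 0 := ii_f (fun q => h.ne q rfl)
lemma ii0'' (h : HT T) (x y : V) : ii (T x y x) = 0 := ii_f (fun q => h.ne (h.s2 q) rfl)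

lemma tt_erase (h : HT T) {X : Finset V} (ha : a ∈ X) :
    tt T X = tt T (X.erase a) + 3 * LL T a (X.erase a) := by
  have e1 : ∀ x, DD (fun y z => ii (T x y z)) X =
      DD (fun y z => ii (T x y z)) (X.erase a) + 2 * ∑ z ∈ X.erase a, ii (T x a z) := fun x =>
    DD_erase (w := fun y z => ii (T x y z)) (fun y z => iis2 h x y z) (fun y => ii0 h x y) ha
  have e2 : tt T X = ∑ x ∈ X, DD (fun y z => ii (T x y z)) X := rfl
  have e3 : tt T (X.erase a) = ∑ x ∈ X.erase a, DD (fun y z => ii (T x y z)) (X.erase a) := rfl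
  rw [e2, ← Finset.add_sum_erase X _ ha, e1 a, Finset.sum_congr rfl (fun x _ => e1 x),
    Finset.sum_add_distrib, ← e3, ← Finset.mul_sum]
  have e4 : ∑ z ∈ X.erase a, ii (T a a z) = 0 := Finset.sum_eq_zero (fun z _ => ii0' h a z)
  have e5 : ∑ x ∈ X.erase a, ∑ z ∈ X.erase a, ii (T x a z) = LL T a (X.erase a) := by
    unfold LL DD
    exact Finset.sum_congr rfl (fun x _ => Finset.sum_congr rfl (fun z _ => iis1 h x a z))
  rw [e4, e5]
  unfold LL
  ring

lemma LL_erase (h : HT T) {X : Finset V} (hb : b ∈ X) :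
    LL T a X = LL T a (X.erase b) + 2 * ∑ z ∈ X.erase b, ii (T a b z) :=
  DD_erase (w := fun y z => ii (T a y z)) (fun y z => iis2 h a y z) (fun y => ii0 h a y) hb

lemma DDwt (W : Finset V) : DD (wt T a b c) W = LL T a W + LL T b W + LL T c W := by
  unfold LL DD wt
  simp only [Finset.sum_add_distrib]

noncomputable def sg (T : V → V → V → Prop) (a b c z : V) : ℕ :=
  ii (T a b z) + ii (T a c z) + ii (T b c z)

lemma tt_dec (h : HT T) {X : Finset V} (ha : a ∈ X) (hb : b ∈ X) (hc : c ∈ X) (t : T a b c) :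
    tt T X = tt T (((X.erase a).erase b).erase c)
      + 3 * DD (wt T a b c) (((X.erase a).erase b).erase c)
      + 6 * ∑ z ∈ ((X.erase a).erase b).erase c, sg T a b c z + 6 := by
  have hab := h.ne t
  have hac := h.ne (h.s2 t)
  have hbc := h.ne (h.r1 t)
  have hb' : b ∈ X.erase a := by simp [hb, hab.symm]
  have hc' : c ∈ (X.erase a).erase b := by simp [hc, hac.symm, hbc.symm]
  rw [tt_erase h ha, tt_erase h hb', tt_erase h hc', LL_erase h hb' (a := a),
    LL_erase h hc' (a := a), LL_erase h hc' (a := b),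
    ← Finset.add_sum_erase ((X.erase a).erase b) (fun z => ii (T a b z)) hc', DDwt, ii_t t]
  unfold sg
  simp only [Finset.sum_add_distrib]
  ring

lemma sg_eq (h : HT T) (t : T a b c) (z : V) :
    sg T a b c z + ii (¬ nU T a b c z) = 1 := by
  have k1 : T a b z → T a c z → False := fun p q => h.K t p q
  have k2 : T a b z → T b c z → False := fun p q => h.K (h.s1 t) (h.s1 p) q
  have k3 : T a c z → T b c z → False := fun p q => h.K (h.r2 t) (h.s1 p) (h.s1 q)
  unfold sg nU
  by_cases x1 : T a b z <;> by_cases x2 : T a c z <;> by_cases x3 : T b c z <;>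
    simp [ii, x1, x2, x3] <;> tauto

lemma sg_sum (h : HT T) (t : T a b c) (W : Finset V) :
    ∑ z ∈ W, sg T a b c z + uu (fun x => ¬ nU T a b c x) W = W.card := by
  unfold uu
  rw [← Finset.sum_add_distrib, Finset.sum_congr rfl (fun z _ => sg_eq h t z)]
  simp

lemma cod_sum (h : HT T) {X : Finset V} (ha : a ∈ X) (hb : b ∈ X) (hc : c ∈ X) (t : T a b c) :
    ∑ z ∈ X, sg T a b c z = 3 + ∑ z ∈ ((X.erase a).erase b).erase c, sg T a b c z := by
  have hab := h.ne t
  have hac := h.ne (h.s2 t)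
  have hbc := h.ne (h.r1 t)
  have hb' : b ∈ X.erase a := by simp [hb, hab.symm]
  have hc' : c ∈ (X.erase a).erase b := by simp [hc, hac.symm, hbc.symm]
  rw [← Finset.add_sum_erase X _ ha, ← Finset.add_sum_erase _ _ hb',
    ← Finset.add_sum_erase _ _ hc']
  have : sg T a b c a + sg T a b c b + sg T a b c c = 3 := by
    unfold sg
    rw [ii0'' h, ii0'' h, ii0 h, ii0'' h, ii0 h, ii0 h, ii_t t, ii_t (h.s2 t), ii_t (h.r1 t)]
  omega

lemma card3 (h : HT T) {X : Finset V} (ha : a ∈ X) (hb : b ∈ X) (hc : c ∈ X) (t : T a b c) :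
    (((X.erase a).erase b).erase c).card + 3 = X.card := by
  have hab := h.ne t
  have hac := h.ne (h.s2 t)
  have hbc := h.ne (h.r1 t)
  have hb' : b ∈ X.erase a := by simp [hb, hab.symm]
  have hc' : c ∈ (X.erase a).erase b := by simp [hc, hac.symm, hbc.symm]
  have a1 := Finset.card_erase_add_one ha
  have a2 := Finset.card_erase_add_one hb'
  have a3 := Finset.card_erase_add_one hc'
  omega

lemma avg (h : HT T) (X : Finset V)
    (hall : ∀ a ∈ X, ∀ b ∈ X, ∀ c ∈ X, T a b c → 3 * (∑ z ∈ X, sg T a b c z) + 1 ≤ 2 * X.card)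
    (hpos : 0 < tt T X) : 9 * tt T X < 2 * X.card * (X.card * (X.card - 1)) := by
  set cod : V → V → ℕ := fun x y => ∑ z ∈ X, ii (T x y z) with hcod
  have hM : tt T X = ∑ x ∈ X, ∑ y ∈ X, cod x y := rfl
  set Q := ∑ x ∈ X, ∑ y ∈ X, cod x y ^ 2 with hQ
  have c1 : ∑ x ∈ X, ∑ y ∈ X, ∑ z ∈ X, ii (T x y z) * cod x y = Q := by
    rw [hQ]
    refine Finset.sum_congr rfl (fun x _ => Finset.sum_congr rfl (fun y _ => ?_))
    rw [← Finset.sum_mul, sq]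
  have c2 : ∑ x ∈ X, ∑ y ∈ X, ∑ z ∈ X, ii (T x y z) * cod x z = Q := by
    rw [← c1]
    refine Finset.sum_congr rfl (fun x _ => ?_)
    rw [Finset.sum_comm]
    refine Finset.sum_congr rfl (fun y _ => Finset.sum_congr rfl (fun z _ => ?_))
    rw [iis2 h]
  have c3 : ∑ x ∈ X, ∑ y ∈ X, ∑ z ∈ X, ii (T x y z) * cod y z = Q := by
    rw [← c2, Finset.sum_comm]
    refine Finset.sum_congr rfl (fun x _ => Finset.sum_congr rfl (fun y _ =>
      Finset.sum_congr rfl (fun z _ => ?_)))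
    rw [iis1 h]
  have c4 : 9 * Q + tt T X ≤ 2 * X.card * tt T X := by
    have : 9 * Q + tt T X = ∑ x ∈ X, ∑ y ∈ X, ∑ z ∈ X,
        ii (T x y z) * (3 * (cod x y + cod x z + cod y z) + 1) := by
      have e : ∀ x y z, ii (T x y z) * (3 * (cod x y + cod x z + cod y z) + 1) =
        3 * (ii (T x y z) * cod x y) + 3 * (ii (T x y z) * cod x z) +
        3 * (ii (T x y z) * cod y z) + ii (T x y z) := fun x y z => by ring
      simp only [e, Finset.sum_add_distrib, ← Finset.mul_sum]
      rw [c1, c2, c3]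
      unfold tt
      ring
    rw [this]
    unfold tt
    simp only [Finset.mul_sum]
    refine Finset.sum_le_sum (fun x hx => Finset.sum_le_sum (fun y hy =>
      Finset.sum_le_sum (fun z hz => ?_)))
    by_cases t : T x y z
    · rw [ii_t t]
      have := hall x hx y hy z hz t
      unfold sg at this
      simp only [Finset.sum_add_distrib] at this
      simp only [hcod]
      omega
    · rw [ii_f t]; simp
  have c5 : (tt T X) ^ 2 ≤ (X.card * (X.card - 1)) * Q := by
    have o1 : tt T X = ∑ p ∈ X.offDiag, cod p.1 p.2 := by
      rw [hM, ← Finset.sum_product']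
      symm
      apply Finset.sum_subset
      · intro p hp
        simp only [Finset.mem_offDiag, Finset.mem_product] at *
        exact ⟨hp.1, hp.2.1⟩
      · intro p hp hq
        simp only [Finset.mem_offDiag, Finset.mem_product] at *
        have : p.1 = p.2 := by tauto
        rw [this]
        exact Finset.sum_eq_zero (fun z _ => ii0' h _ z)
    have o2 : ∑ p ∈ X.offDiag, cod p.1 p.2 ^ 2 ≤ Q := by
      rw [hQ, ← Finset.sum_product']
      apply Finset.sum_le_sum_of_subset
      intro p hp
      simp only [Finset.mem_offDiag, Finset.mem_product] at *
      exact ⟨hp.1, hp.2.1⟩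
    have o3 : X.offDiag.card = X.card * (X.card - 1) := by
      rw [Finset.offDiag_card, Nat.mul_sub, mul_one]
    rw [o1, ← o3]
    exact (sq_sum_le_card_mul_sum_sq).trans (Nat.mul_le_mul_left _ o2)
  generalize tt T X = M at *
  generalize X.card * (X.card - 1) = p at *
  generalize X.card = n at *
  by_contra hh
  push Not at hh
  have d1 : 9 * M ^ 2 ≤ p * (9 * Q) := by nlinarith
  have d2 : p * (9 * Q) + p * M ≤ 2 * n * p * M := by nlinarith
  have d3 : 2 * n * p * M ≤ 9 * M * M := by nlinarith
  have : p * M = 0 := by nlinarith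
  rcases Nat.mul_eq_zero.mp this with r | r
  · rw [r] at c5; nlinarith
  · omega

end cnt

section fin
variable {V : Type*} [DecidableEq V] {T : V → V → V → Prop} {a b c : V}

lemma quad (h : HT T) (x y z w : V) :
    ii (T x y z) + ii (T x y w) + ii (T x z w) + ii (T y z w) ≤ 2 := by
  have k1 : T x y z → T x y w → T x z w → False := fun p q r => h.K p q r
  have k2 : T x y z → T x y w → T y z w → False := fun p q r => h.K (h.s1 p) (h.s1 q) r
  have k3 : T x y z → T x z w → T y z w → False := fun p q r => h.K (h.r2 p) (h.s1 q) (h.s1 r)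
  have k4 : T x y w → T x z w → T y z w → False := fun p q r => h.K (h.r2 p) (h.r2 q) (h.r2 r)
  by_cases x1 : T x y z <;> by_cases x2 : T x y w <;> by_cases x3 : T x z w <;>
    by_cases x4 : T y z w <;> simp [ii, x1, x2, x3, x4] <;> tauto

lemma link5 (h : HT T) {x y z s t : V} (e1 : T x y z) (e2 : T y z s) (e3 : T z s t)
    (e4 : T x s t) (e5 : T x y t) {W : Finset V} (hW : W = {x, y, z, s, t}) (ha : a ∉ W) :
    LL T a W ≤ 4 := by
  have n1 := h.ne e1
  have n2 := h.ne e2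
  have n3 := h.ne e3
  have n4 := h.ne e4
  have n5 := h.ne (h.s2 e1)
  have n6 := h.ne (h.s2 e2)
  have n7 := h.ne (h.s2 e3)
  have n8 := h.ne (h.s2 e4)
  have n9 := h.ne (h.r1 e5)
  have n10 := h.ne (h.r1 e4)
  subst hW
  have ha' : a ≠ x ∧ a ≠ y ∧ a ≠ z ∧ a ≠ s ∧ a ≠ t := by simpa using ha
  obtain ⟨a1, a2, a3, a4, a5⟩ := ha'
  have gen : ∀ v0 v1 v2 v3 v4 : V, T v0 v1 v2 → T v1 v2 v3 → T v0 v3 v4 → a ≠ v2 → a ≠ v0 →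
      a ≠ v3 → ¬ T a v1 v4 := by
    intro v0 v1 v2 v3 v4 q1 q2 q3 m1 m2 m3 q
    rcases h.F (h.r1 q1) q2 q3 (h.r1 q) with r | r | r <;> tauto
  have f1 := ii_f (gen x y z s t e1 e2 e4 a3 a1 a4)
  have f2 := ii_f (gen y z s t x e2 e3 (h.r1 e5) a4 a2 a5)
  have f3 := ii_f (gen z s t x y e3 (h.r1 e4) (h.r2 e1) a5 a3 a1)
  have f4 := ii_f (gen s t x y z (h.r1 e4) (h.r2 e5) (h.r2 e2) a1 a4 a2)
  have f5 := ii_f (gen t x y z s (h.r2 e5) e1 (h.r2 e3) a2 a5 a3)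
  have g1 := quad h a x y z
  have g2 := quad h a y z s
  have g3 := quad h a z s t
  have g4 := quad h a x s t
  have g5 := quad h a x y t
  rw [ii_t e1] at g1
  rw [ii_t e2] at g2
  rw [ii_t e3] at g3
  rw [ii_t e4] at g4
  rw [ii_t e5] at g5
  have key : LL T a {x, y, z, s, t} = 2 * (ii (T a x y) + ii (T a x z) + ii (T a x s) +
      ii (T a x t) + ii (T a y z) + ii (T a y s) + ii (T a y t) + ii (T a z s) + ii (T a z t)
      + ii (T a s t)) := by
    unfold LL DD
    simp only [Finset.sum_insert, Finset.mem_insert, Finset.mem_singleton, n1, n2, n3, n4, n5, n6,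
      n7, n8, n9, n10, or_self, not_false_eq_true, Finset.sum_singleton, ii0 h]
    rw [iis2 h a y x, iis2 h a z x, iis2 h a s x, iis2 h a t x, iis2 h a z y, iis2 h a s y,
      iis2 h a t y, iis2 h a s z, iis2 h a t z, iis2 h a t s]
    ring
  rw [iis2 h a z x] at f2
  rw [iis2 h a s y] at f3
  rw [iis2 h a t z] at f4
  omega

lemma of_ii {p : Prop} (h : ii p = 1) : p := by
  by_contra q
  rw [ii_f q] at h
  omega

lemma c5 (h : HT T) {W : Finset V} (hc : W.card = 5) (ht : 24 < tt T W) (ha : a ∉ W) :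
    LL T a W ≤ 4 := by
  have : ∃ p ∈ W, ∃ q ∈ W, ∃ r ∈ W, T p q r := by
    by_contra hh
    push Not at hh
    have : tt T W = 0 := Finset.sum_eq_zero (fun x hx => Finset.sum_eq_zero (fun y hy =>
      Finset.sum_eq_zero (fun z hz => ii_f (hh x hx y hy z hz))))
    omega
  obtain ⟨p, hp, q, hq, r, hr, e⟩ := this
  have hcc := card3 h hp hq hr e
  have hd := tt_dec h hp hq hr e
  obtain ⟨s, t, hst, hR⟩ := Finset.card_eq_two.mp (show (((W.erase p).erase q).erase r).card = 2
    by omega)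
  have hW : W = {p, q, r, s, t} := by
    have : insert p (insert q (insert r (((W.erase p).erase q).erase r))) = W := by
      ext v
      simp only [Finset.mem_insert, Finset.mem_erase]
      constructor
      · rintro (rfl | rfl | rfl | k)
        · exact hp
        · exact hq
        · exact hr
        · exact k.2.2.2
      · tauto
    rw [hR] at this
    exact this.symm
  rw [hR] at hd
  have z1 : tt T {s, t} = 0 := by
    unfold tt
    simp [Finset.sum_pair hst, ii0 h, ii0' h, ii0'' h]
  have z2 : DD (wt T p q r) {s, t} = 2 * wt T p q r s t := by
    unfold DD
    rw [Finset.sum_pair hst, Finset.sum_pair hst, Finset.sum_pair hst, wt0 h, wt0 h,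
      wtsymm h t s]
    ring
  rw [z1, z2, Finset.sum_pair hst] at hd
  have q1 := quad h p q r s
  have q2 := quad h p q r t
  have q3 := quad h p q s t
  have q4 := quad h p r s t
  have q5 := quad h q r s t
  unfold sg wt at hd
  rw [ii_t e] at q1 q2
  have l1 := ii_le (T p s t)
  have l2 := ii_le (T q s t)
  have l3 := ii_le (T r s t)
  have hs : ii (T p q s) = 1 ∨ ii (T p r s) = 1 ∨ ii (T q r s) = 1 := by omega
  have ht' : ii (T p q t) = 1 ∨ ii (T p r t) = 1 ∨ ii (T q r t) = 1 := by omega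
  rcases hs with i | i | i <;> rcases ht' with j | j | j
  · omega
  · have k1 : ii (T r s t) = 1 := by omega
    have k2 : ii (T q s t) = 1 := by omega
    exact link5 h (h.r3 (h.s1 e)) (of_ii i) (of_ii k2) (of_ii k1) (h.s1 (of_ii j))
      (by rw [hW]; ext; simp; tauto) ha
  · have k1 : ii (T r s t) = 1 := by omega
    have k2 : ii (T p s t) = 1 := by omega
    exact link5 h (h.r3 e) (h.s1 (of_ii i)) (of_ii k2) (of_ii k1) (h.s1 (of_ii j))
      (by rw [hW]; ext; simp; tauto) ha
  · have k1 : ii (T r s t) = 1 := by omega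
    have k2 : ii (T q s t) = 1 := by omega
    exact link5 h (h.s1 e) (of_ii i) (of_ii k1) (of_ii k2) (h.s1 (of_ii j))
      (by rw [hW]; ext; simp; tauto) ha
  · omega
  · have k1 : ii (T q s t) = 1 := by omega
    have k2 : ii (T p s t) = 1 := by omega
    exact link5 h (h.r1 e) (h.s1 (of_ii i)) (of_ii k2) (of_ii k1) (of_ii j)
      (by rw [hW]; ext; simp; tauto) ha
  · have k1 : ii (T p s t) = 1 := by omega
    have k2 : ii (T r s t) = 1 := by omega
    exact link5 h e (of_ii i) (of_ii k2) (of_ii k1) (of_ii j)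
      (by rw [hW]) ha
  · have k1 : ii (T p s t) = 1 := by omega
    have k2 : ii (T q s t) = 1 := by omega
    exact link5 h (h.s2 e) (h.s1 (of_ii i)) (of_ii k2) (of_ii k1) (of_ii j)
      (by rw [hW]; ext; simp; tauto) ha
  · omega

lemma s3_step (N : ℕ) : s3 (N + 3) = s3 N + N * N / 3 + N + 1 := by
  unfold s3
  obtain ⟨m, r, hr, rfl⟩ : ∃ m r, r < 3 ∧ N = 3 * m + r := ⟨N / 3, N % 3, by omega, by omega⟩
  interval_cases r
  · rw [show (3 * m + 0 + 3) / 3 = m + 1 by omega, show (3 * m + 0 + 3 + 1) / 3 = m + 1 by omega,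
      show (3 * m + 0 + 3 + 2) / 3 = m + 1 by omega, show (3 * m + 0) / 3 = m by omega,
      show (3 * m + 0 + 1) / 3 = m by omega, show (3 * m + 0 + 2) / 3 = m by omega,
      show (3 * m + 0) * (3 * m + 0) = 3 * (3 * m * m) by ring, Nat.mul_div_cancel_left _ (by omega)]
    ring
  · rw [show (3 * m + 1 + 3) / 3 = m + 1 by omega, show (3 * m + 1 + 3 + 1) / 3 = m + 1 by omega,
      show (3 * m + 1 + 3 + 2) / 3 = m + 2 by omega, show (3 * m + 1) / 3 = m by omega,
      show (3 * m + 1 + 1) / 3 = m by omega, show (3 * m + 1 + 2) / 3 = m + 1 by omega,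
      show (3 * m + 1) * (3 * m + 1) = 1 + 3 * (3 * m * m + 2 * m) by ring,
      Nat.add_mul_div_left _ _ (by omega)]
    ring_nf
  · rw [show (3 * m + 2 + 3) / 3 = m + 1 by omega, show (3 * m + 2 + 3 + 1) / 3 = m + 2 by omega,
      show (3 * m + 2 + 3 + 2) / 3 = m + 2 by omega, show (3 * m + 2) / 3 = m by omega,
      show (3 * m + 2 + 1) / 3 = m + 1 by omega, show (3 * m + 2 + 2) / 3 = m + 1 by omega,
      show (3 * m + 2) * (3 * m + 2) = 4 + 3 * (3 * m * m + 4 * m) by ring,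
      Nat.add_mul_div_left _ _ (by omega)]
    ring_nf

lemma s3_low (k : ℕ) : k * (k * (k - 1)) ≤ 27 * s3 k + 4 := by
  unfold s3
  obtain ⟨m, r, hr, rfl⟩ : ∃ m r, r < 3 ∧ k = 3 * m + r := ⟨k / 3, k % 3, by omega, by omega⟩
  interval_cases r
  · rw [show (3 * m + 0) / 3 = m by omega,
      show (3 * m + 0 + 1) / 3 = m by omega, show (3 * m + 0 + 2) / 3 = m by omega]
    have : (3 * m + 0) * ((3 * m + 0) * (3 * m + 0 - 1)) ≤ 
      (3 * m + 0) * ((3 * m + 0) * (3 * m)) := by gcongr; omega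
    nlinarith
  · rw [show (3 * m + 1) / 3 = m by omega, show 3 * m + 1 - 1 = 3 * m by omega,
      show (3 * m + 1 + 1) / 3 = m by omega, show (3 * m + 1 + 2) / 3 = m + 1 by omega]
    nlinarith
  · rw [show (3 * m + 2) / 3 = m by omega, show 3 * m + 2 - 1 = 3 * m + 1 by omega,
      show (3 * m + 2 + 1) / 3 = m + 1 by omega, show (3 * m + 2 + 2) / 3 = m + 1 by omega]
    nlinarith

lemma main_ind (h : HT T) : ∀ (k : ℕ) (X : Finset V), X.card = k →
    tt T X ≤ 6 * s3 k + (if k = 5 then 6 else 0) := by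
  intro k
  induction k using Nat.strong_induction_on with
  | _ k ih =>
  intro X hX
  by_contra hbad
  push Not at hbad
  have hlow := s3_low k
  have hex : ∃ a ∈ X, ∃ b ∈ X, ∃ c ∈ X, T a b c ∧ 2 * X.card ≤ 3 * (∑ z ∈ X, sg T a b c z) := by
    by_contra hh
    push Not at hh
    have := avg h X (fun a ha b hb c hc t => by have := hh a ha b hb c hc t; omega) (by omega)
    rw [hX] at this
    have e : 2 * k * (k * (k - 1)) = 2 * (k * (k * (k - 1))) := by ring
    rw [e] at this
    omega
  obtain ⟨a, ha, b, hb, c, hc, t, hs⟩ := hex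
  have h1 := cod_sum h ha hb hc t
  have h2 := card3 h ha hb hc t
  have h3 := tt_dec h ha hb hc t
  have hoff : ∀ x ∈ ((X.erase a).erase b).erase c, off a b c x := by
    intro x hx
    simp only [Finset.mem_erase] at hx
    exact ⟨hx.2.2.1, hx.2.1, hx.1⟩
  generalize hWd : ((X.erase a).erase b).erase c = W at *
  have h4 := sg_sum h t W
  have h5 := lem2 W.card W rfl (mkAW h t W hoff) (by omega)
  generalize uu (fun x => ¬ nU T a b c x) W = u at *
  have h6 := ih W.card (by omega) W rfl
  have h7 := s3_step W.card
  rw [h2, hX] at h7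
  by_cases hN5 : W.card = 5
  · by_cases h24 : tt T W ≤ 24
    · rw [hN5] at h5 h7
      have : gg 5 u = 0 := by simp [gg]
      rw [this] at h5
      have e5 : s3 5 = 4 := by decide
      rw [e5] at h7
      norm_num at h7 h5
      omega
    · have o := fun {v} (hv : v ∉ W) => c5 h hN5 (by omega : 24 < tt T W) hv
      have oa := o (fun q => (hoff a q).1 rfl)
      have ob := o (fun q => (hoff b q).2.1 rfl)
      have oc := o (fun q => (hoff c q).2.2 rfl)
      rw [DDwt] at h3
      have e5 : s3 5 = 4 := by decide
      rw [hN5, e5] at h7 h6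
      norm_num at h7 h6
      omega
  · rw [if_neg hN5] at h6
    have hg : 6 * gg W.card u ≤ if k = 5 then 6 else 0 := by
      unfold gg
      split_ifs <;> omega
    omega

end fin

/-- Exact Turán number: for `n ≥ 3`, `n ≠ 5`, an `{K₄⁻, F₆}`-free 3-graph on `n`
vertices has at most `s₃(n)` edges. -/
theorem turan_number_F {V : Type*} [DecidableEq V] [Fintype V] (n : ℕ) (hn : 3 ≤ n)
    (hn5 : n ≠ 5) (hV : Fintype.card V = n) (E : Finset (Finset V))
    (h3 : ∀ e ∈ E, e.card = 3) (hK : K4mFree E) (hF : F6Free E) :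
    E.card ≤ s3 n := by
  have hdis : ∀ {x y z : V}, ({x, y, z} : Finset V) ∈ E → x ≠ y ∧ x ≠ z ∧ y ≠ z := by
    intro x y z hm
    have := h3 _ hm
    refine ⟨?_, ?_, ?_⟩ <;> rintro rfl
    · have := Finset.card_le_two (a := x) (b := z)
      simp at *
      omega
    · have := Finset.card_le_two (a := x) (b := y)
      rw [show ({x, y, x} : Finset V) = {x, y} by ext; simp; tauto] at *
      omega
    · have := Finset.card_le_two (a := x) (b := y)
      simp at *
      omega
  have p1 : ∀ x y z : V, ({x, y, z} : Finset V) = {y, x, z} := by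
    intro x y z; ext; simp; tauto
  have p2 : ∀ x y z : V, ({x, y, z} : Finset V) = {x, z, y} := by
    intro x y z; ext; simp; tauto
  have hKK : ∀ {x y z w : V}, ({x, y, z} : Finset V) ∈ E → ({x, y, w} : Finset V) ∈ E →
      ({x, z, w} : Finset V) ∈ E → False := by
    intro x y z w e1 e2 e3
    obtain ⟨a1, a2, a3⟩ := hdis e1
    obtain ⟨b1, b2, b3⟩ := hdis e2
    obtain ⟨c1, c2, c3⟩ := hdis e3
    exact hK ⟨x, y, z, w, a1, a2, b2, a3, b3, c3, e1, e2, e3⟩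
  have H : HT (fun x y z : V => ({x, y, z} : Finset V) ∈ E) := by
    constructor
    · intro x y z q; rw [p1]; exact q
    · intro x y z q; rw [p2]; exact q
    · intro x y z q; exact (hdis q).1
    · intro x y z w e1 e2 e3; exact hKK e1 e2 e3
    · intro u v w x p y e1 e2 e3 e4
      by_contra hh
      push Not at hh
      obtain ⟨a1, a2, a3⟩ := hdis e1
      obtain ⟨b1, b2, b3⟩ := hdis e2
      obtain ⟨c1, c2, c3⟩ := hdis e3
      obtain ⟨d1, d2, d3⟩ := hdis e4
      have hpv : p ≠ v := by
        rintro rfl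
        rw [p1] at e1 e2
        rw [p2, p1] at e3
        exact hKK e1 e2 e3
      refine hF ⟨u, v, w, x, p, y, ?_, e1, e2, e3, e4⟩
      simp only [List.nodup_cons, List.mem_cons, List.not_mem_nil, or_false, not_or,
        not_false_eq_true, List.nodup_nil, and_true]
      refine ⟨⟨a1, a2, b2, d1, d2⟩, ⟨a3, b3, hpv.symm, hh.1.symm⟩, ⟨c1, c2, hh.2.1.symm⟩,
        ⟨c3, hh.2.2.symm⟩, d3⟩
  have hm := main_ind H n Finset.univ (by rw [Finset.card_univ, hV])
  rw [if_neg hn5] at hm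
  have hcount : 6 * E.card ≤ tt (fun x y z : V => ({x, y, z} : Finset V) ∈ E) Finset.univ := by
    set P : Finset (V × V × V) :=
      Finset.univ.filter (fun q => ({q.1, q.2.1, q.2.2} : Finset V) ∈ E) with hP
    have t1 : tt (fun x y z : V => ({x, y, z} : Finset V) ∈ E) Finset.univ = P.card := by
      rw [hP, Finset.card_filter, Fintype.sum_prod_type]
      unfold tt
      refine Finset.sum_congr rfl (fun x _ => ?_)
      rw [Fintype.sum_prod_type]
      refine Finset.sum_congr rfl (fun y _ => Finset.sum_congr rfl (fun z _ => ?_))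
      unfold ii
      split_ifs <;> rfl
    rw [t1, Finset.card_eq_sum_card_fiberwise (t := E)
      (f := fun q : V × V × V => ({q.1, q.2.1, q.2.2} : Finset V))
      (fun q hq => by simpa [hP] using hq)]
    rw [mul_comm, ← smul_eq_mul]
    refine Finset.card_nsmul_le_sum _ _ _ (fun e he => ?_)
    obtain ⟨x, y, z, hxy, hxz, hyz, rfl⟩ := Finset.card_eq_three.mp (h3 e he)
    have hc : ({(x, y, z), (x, z, y), (y, x, z), (y, z, x), (z, x, y), (z, y, x)} :
        Finset (V × V × V)).card = 6 := by
      simp [Finset.card_insert_of_notMem, hxy, hxz, hyz, hxy.symm, hxz.symm, hyz.symm]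
    rw [← hc]
    apply Finset.card_le_card
    have aux : ∀ x' y' z' : V, ({x', y', z'} : Finset V) = {x, y, z} →
        (x', y', z') ∈ P.filter (fun q => ({q.1, q.2.1, q.2.2} : Finset V) = {x, y, z}) := by
      intro x' y' z' hq
      simp only [hP, Finset.mem_filter, Finset.mem_univ, true_and, hq, and_true]
      exact he
    intro q hq
    simp only [Finset.mem_insert, Finset.mem_singleton] at hq
    rcases hq with rfl | rfl | rfl | rfl | rfl | rfl 
    · exact aux x y z rfl
    · exact aux x z y (p2 _ _ _)
    · exact aux y x z (p1 _ _ _)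
    · exact aux y z x ((p2 _ _ _).trans (p1 _ _ _))
    · exact aux z x y ((p1 _ _ _).trans (p2 _ _ _))
    · exact aux z y x ((p1 _ _ _).trans ((p2 _ _ _).trans (p1 _ _ _)))
  omega
end
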